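/- Fix β ∈ (−1,1). As Δ = 2−α → 0⁺, the mixed Fisher information of scale and skewness satisfies I_{σβ}(α) / (Δ·log(log(1/Δ))) → 0, i.e. I_{σβ}(α) = o(Δ·log(log(1/Δ))), where I_{σβ}(α) = ∫_ℝ f_σ(x;α,β)·f_β(x;α,β) / f(x;α,β) dx. -/

import Mathlib

open MeasureTheory Filter Set Topology Real

/-- Shift parameter ζ = −β·tan(πα/2) in Zolotarev's (M) parameterization. -/
noncomputable def zetaPar (α β : ℝ) : ℝ := -β * Real.tan (Real.pi * α / 2)

/-- Standard stable density in Zolotarev's (M) parameterization, via the inversion formula. -/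
noncomputable def stableDensity (α β x : ℝ) : ℝ :=
  (1 / Real.pi) *
    (∫ t in Set.Ioi (0 : ℝ),
      Complex.exp (-(Complex.I * (t : ℂ) * (x : ℂ))) *
        Complex.exp (-(((t ^ α : ℝ) : ℂ)) *
          (1 + Complex.I * (β : ℂ) * ((Real.tan (Real.pi * α / 2) : ℝ) : ℂ) *
            (((t ^ (1 - α) : ℝ) : ℂ) - 1)))).re

/-- The N(0,2) density f(y;2). -/
noncomputable def normalDensity (y : ℝ) : ℝ :=
  (1 / (2 * Real.sqrt Real.pi)) * Real.exp (-(y ^ 2) / 4)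

/-- Partial derivative of the stable density with respect to α. -/
noncomputable def fAlpha (α β x : ℝ) : ℝ := deriv (fun a : ℝ => stableDensity a β x) α

/-- Partial derivative of the stable density with respect to β. -/
noncomputable def fBeta (α β x : ℝ) : ℝ := deriv (fun b : ℝ => stableDensity α b x) β

/-- Derivative of the stable density in x. -/
noncomputable def fX (α β x : ℝ) : ℝ := deriv (stableDensity α β) x

/-- The scale score numerator f_σ = −f − x·f′. -/
noncomputable def fSig (α β x : ℝ) : ℝ := -stableDensity α β x - x * fX α β x

/-- Symbol-type bounds: each derivative costs a factor `1/t`. -/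
def SymB : ℕ → (ℝ → ℂ) → (ℝ → ℝ) → Prop
  | 0, g, b => ContinuousOn g (Ioi 0) ∧ ∀ t, 0 < t → ‖g t‖ ≤ b t
  | n + 1, g, b => (∀ t, 0 < t → ‖g t‖ ≤ b t) ∧
      ∃ g' : ℝ → ℂ, (∀ t, 0 < t → HasDerivAt g (g' t) t) ∧ SymB n g' (fun t => b t / t)

lemma SymB.bound {n : ℕ} {g : ℝ → ℂ} {b : ℝ → ℝ} (h : SymB n g b) :
    ∀ t, 0 < t → ‖g t‖ ≤ b t := by
  cases n with
  | zero => exact h.2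
  | succ n => exact h.1

lemma SymB.cont {n : ℕ} {g : ℝ → ℂ} {b : ℝ → ℝ} (h : SymB n g b) :
    ContinuousOn g (Ioi 0) := by
  cases n with
  | zero => exact h.1
  | succ n =>
    obtain ⟨_, g', hg, _⟩ := h
    intro t ht
    exact (hg t ht).continuousAt.continuousWithinAt

lemma SymB.mono {n : ℕ} : ∀ {g : ℝ → ℂ} {b c : ℝ → ℝ}, SymB n g b →
    (∀ t, 0 < t → b t ≤ c t) → SymB n g c := by
  induction n with
  | zero => intro g b c h hbc; exact ⟨h.1, fun t ht => (h.2 t ht).trans (hbc t ht)⟩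
  | succ n ih =>
    intro g b c h hbc
    obtain ⟨h1, g', h2, h3⟩ := h
    refine ⟨fun t ht => (h1 t ht).trans (hbc t ht), g', h2, ih h3 ?_⟩
    intro t ht
    have := hbc t ht
    gcongr

lemma SymB.congr {n : ℕ} : ∀ {g h : ℝ → ℂ} {b : ℝ → ℝ}, SymB n g b →
    (∀ t, 0 < t → h t = g t) → SymB n h b := by
  intro g h b hg hh
  cases n with
  | zero =>
    exact ⟨hg.1.congr (fun t ht => hh t ht), fun t ht => by rw [hh t ht]; exact hg.2 t ht⟩
  | succ n =>
    obtain ⟨h1, g', h2, h3⟩ := hg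
    refine ⟨fun t ht => by rw [hh t ht]; exact h1 t ht, g', fun t ht => ?_, h3⟩
    refine (h2 t ht).congr_of_eventuallyEq ?_
    filter_upwards [Ioi_mem_nhds ht] with s hs using hh s hs

lemma SymB.pred {n : ℕ} : ∀ {g : ℝ → ℂ} {b : ℝ → ℝ}, SymB (n + 1) g b → SymB n g b := by
  induction n with
  | zero => intro g b h; exact ⟨h.cont, h.bound⟩
  | succ n ih =>
    intro g b h
    obtain ⟨h1, g', h2, h3⟩ := h
    exact ⟨h1, g', h2, ih h3⟩

lemma SymB.le {n m : ℕ} (hm : m ≤ n) {g : ℝ → ℂ} {b : ℝ → ℝ} (h : SymB n g b) : SymB m g b := by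
  induction n, hm using Nat.le_induction with
  | base => exact h
  | succ n _ ih => exact ih h.pred

lemma SymB.add {n : ℕ} : ∀ {g h : ℝ → ℂ} {b c : ℝ → ℝ}, SymB n g b → SymB n h c →
    SymB n (fun t => g t + h t) (fun t => b t + c t) := by
  induction n with
  | zero =>
    intro g h b c hg hh
    exact ⟨hg.1.add hh.1, fun t ht => (norm_add_le _ _).trans (add_le_add (hg.2 t ht) (hh.2 t ht))⟩
  | succ n ih =>
    intro g h b c hg hh
    obtain ⟨h1, g', h2, h3⟩ := hg
    obtain ⟨k1, h', k2, k3⟩ := hh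
    refine ⟨fun t ht => (norm_add_le _ _).trans (add_le_add (h1 t ht) (k1 t ht)),
      fun t => g' t + h' t, fun t ht => (h2 t ht).add (k2 t ht), (ih h3 k3).mono ?_⟩
    intro t ht
    rw [add_div]

lemma SymB.mul {n : ℕ} : ∀ {g h : ℝ → ℂ} {b c : ℝ → ℝ}, SymB n g b → SymB n h c →
    SymB n (fun t => g t * h t) (fun t => 2 ^ n * (b t * c t)) := by
  induction n with
  | zero =>
    intro g h b c hg hh
    refine ⟨hg.1.mul hh.1, fun t ht => ?_⟩
    have h1 := hg.2 t ht
    have h2 := hh.2 t ht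
    have := (norm_nonneg _).trans h1
    simp only [norm_mul, pow_zero, one_mul]
    gcongr
  | succ n ih =>
    intro g h b c hg hh
    have hg' := hg.pred
    have hh' := hh.pred
    obtain ⟨h1, g', h2, h3⟩ := hg
    obtain ⟨k1, h', k2, k3⟩ := hh
    refine ⟨fun t ht => ?_, fun t => g' t * h t + g t * h' t,
      fun t ht => (h2 t ht).mul (k2 t ht), ((ih h3 hh').add (ih hg' k3)).mono ?_⟩
    · have e1 := h1 t ht
      have e2 := k1 t ht
      have e3 := (norm_nonneg _).trans e1
      have e4 := (norm_nonneg _).trans e2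
      rw [norm_mul]
      have : ‖g t‖ * ‖h t‖ ≤ b t * c t := by gcongr
      have h1 : (1 : ℝ) ≤ 2 ^ (n + 1) := one_le_pow₀ (by norm_num)
      nlinarith [mul_nonneg e3 e4]
    · intro t ht
      apply le_of_eq
      have := ht.ne'
      field_simp
      ring

/-- Weight. -/
noncomputable def wt (p : ℝ) (k e : ℕ) (t : ℝ) : ℝ := t ^ p * (1 + t) ^ k * Real.exp (-(e * t))

lemma wt_nonneg (p : ℝ) (k e : ℕ) {t : ℝ} (ht : 0 < t) : 0 ≤ wt p k e t := by
  unfold wt; positivity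

lemma wt_mul (p q : ℝ) (k l e f : ℕ) {t : ℝ} (ht : 0 < t) :
    wt p k e t * wt q l f t = wt (p + q) (k + l) (e + f) t := by
  unfold wt
  rw [Real.rpow_add ht, pow_add]
  push_cast
  rw [show -(((e : ℝ) + f) * t) = -(e * t) + -(f * t) by ring, Real.exp_add]
  ring

lemma wt_div (p : ℝ) (k e : ℕ) {t : ℝ} (ht : 0 < t) :
    wt p k e t / t = wt (p - 1) k e t := by
  unfold wt
  rw [Real.rpow_sub ht, Real.rpow_one]
  ring

lemma wt_mono_k (p : ℝ) {k l : ℕ} (h : k ≤ l) (e : ℕ) {t : ℝ} (ht : 0 < t) :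
    wt p k e t ≤ wt p l e t := by
  unfold wt
  have : (1 + t) ^ k ≤ (1 + t) ^ l := pow_le_pow_right₀ (by linarith) h
  gcongr

lemma wt_mono_p {p q : ℝ} (h : q ≤ p) (k e : ℕ) {t : ℝ} (ht : 0 < t) :
    wt p k e t ≤ wt q (k + ⌈p - q⌉₊) e t := by
  unfold wt
  have h1 : t ^ p ≤ t ^ q * (1 + t) ^ ⌈p - q⌉₊ := by
    have : t ^ p = t ^ q * t ^ (p - q) := by rw [← Real.rpow_add ht]; ring_nf
    rw [this]
    have h2 : t ^ (p - q) ≤ (1 + t) ^ (p - q) :=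
      Real.rpow_le_rpow ht.le (by linarith) (by linarith)
    have h3 : (1 + t) ^ (p - q) ≤ (1 + t) ^ ((⌈p - q⌉₊ : ℕ) : ℝ) :=
      Real.rpow_le_rpow_of_exponent_le (by linarith) (Nat.le_ceil _)
    rw [Real.rpow_natCast] at h3
    have := h2.trans h3
    gcongr
  calc t ^ p * (1 + t) ^ k * Real.exp (-(e * t))
      ≤ (t ^ q * (1 + t) ^ ⌈p - q⌉₊) * (1 + t) ^ k * Real.exp (-(e * t)) := by gcongr
    _ = _ := by rw [pow_add]; ring

/-- Uniform families of symbols. -/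
def FS (n j : ℕ) (p : ℝ) (e : ℕ) (g : ℝ → ℝ → ℂ) : Prop :=
  ∃ C : ℝ, ∃ k : ℕ, 0 ≤ C ∧ ∀ Δ, 0 < Δ → Δ ≤ 1 / 8 →
    SymB n (g Δ) (fun t => C * Δ ^ j * wt p k e t)

lemma FS.congr {n j : ℕ} {p : ℝ} {e : ℕ} {g h : ℝ → ℝ → ℂ} (hg : FS n j p e g)
    (hh : ∀ Δ, 0 < Δ → Δ ≤ 1 / 8 → ∀ t, 0 < t → h Δ t = g Δ t) : FS n j p e h := by
  obtain ⟨C, k, hC, H⟩ := hg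
  exact ⟨C, k, hC, fun Δ h1 h2 => (H Δ h1 h2).congr (hh Δ h1 h2)⟩

lemma FS.le {n m j : ℕ} {p : ℝ} {e : ℕ} {g : ℝ → ℝ → ℂ} (hg : FS n j p e g)
    (hm : m ≤ n) : FS m j p e g := by
  obtain ⟨C, k, hC, H⟩ := hg
  exact ⟨C, k, hC, fun Δ h1 h2 => (H Δ h1 h2).le hm⟩

lemma FS.mono_p {n j : ℕ} {p : ℝ} {e : ℕ} {g : ℝ → ℝ → ℂ} (hg : FS n j p e g) {q : ℝ}
    (hq : q ≤ p) : FS n j q e g := by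
  obtain ⟨C, k, hC, H⟩ := hg
  refine ⟨C, k + ⌈p - q⌉₊, hC, fun Δ h1 h2 => (H Δ h1 h2).mono fun t ht => ?_⟩
  have := wt_mono_p hq k e ht
  gcongr

lemma FS.mono_j {n j : ℕ} {p : ℝ} {e : ℕ} {g : ℝ → ℝ → ℂ} (hg : FS n j p e g) {i : ℕ}
    (hq : i ≤ j) : FS n i p e g := by
  obtain ⟨C, k, hC, H⟩ := hg
  refine ⟨C, k, hC, fun Δ h1 h2 => (H Δ h1 h2).mono fun t ht => ?_⟩
  have := wt_nonneg p k e ht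
  have : Δ ^ j ≤ Δ ^ i := pow_le_pow_of_le_one h1.le (by linarith) hq
  gcongr

lemma FS.add {n j : ℕ} {p : ℝ} {e : ℕ} {g h : ℝ → ℝ → ℂ} (hg : FS n j p e g)
    (hh : FS n j p e h) : FS n j p e (fun Δ t => g Δ t + h Δ t) := by
  obtain ⟨C, k, hC, H⟩ := hg
  obtain ⟨D, l, hD, K⟩ := hh
  refine ⟨C + D, max k l, by positivity, fun Δ h1 h2 => ((H Δ h1 h2).add (K Δ h1 h2)).mono ?_⟩
  intro t ht
  have a1 := wt_mono_k p (le_max_left k l) e ht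
  have a2 := wt_mono_k p (le_max_right k l) e ht
  calc _ ≤ C * Δ ^ j * wt p (max k l) e t + D * Δ ^ j * wt p (max k l) e t := by gcongr
    _ = _ := by ring

lemma FS.mul {n j1 j2 j : ℕ} {p1 p2 p : ℝ} {e1 e2 e : ℕ} {g h : ℝ → ℝ → ℂ}
    (hg : FS n j1 p1 e1 g) (hh : FS n j2 p2 e2 h) (hj : j = j1 + j2) (hp : p = p1 + p2)
    (he : e = e1 + e2) : FS n j p e (fun Δ t => g Δ t * h Δ t) := by
  obtain ⟨C, k, hC, H⟩ := hg
  obtain ⟨D, l, hD, K⟩ := hh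
  refine ⟨2 ^ n * (C * D), k + l, by positivity,
    fun Δ h1 h2 => ((H Δ h1 h2).mul (K Δ h1 h2)).mono ?_⟩
  intro t ht
  apply le_of_eq
  rw [hj, hp, he, ← wt_mul p1 p2 k l e1 e2 ht, pow_add]
  ring

lemma FS.succ {n j : ℕ} {p : ℝ} {e : ℕ} {g g' : ℝ → ℝ → ℂ} (h0 : FS 0 j p e g)
    (hd : ∀ Δ, 0 < Δ → Δ ≤ 1 / 8 → ∀ t, 0 < t → HasDerivAt (g Δ) (g' Δ t) t)
    (hg' : FS n j (p - 1) e g') : FS (n + 1) j p e g := by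
  obtain ⟨C, k, hC, H⟩ := h0
  obtain ⟨D, l, hD, K⟩ := hg'
  refine ⟨C + D, max k l, by positivity, fun Δ h1 h2 => ⟨fun t ht => ?_, g' Δ, hd Δ h1 h2,
    (K Δ h1 h2).mono ?_⟩⟩
  · refine ((H Δ h1 h2).bound t ht).trans ?_
    show C * Δ ^ j * wt p k e t ≤ (C + D) * Δ ^ j * wt p (max k l) e t
    have a1 := wt_mono_k p (le_max_left k l) e ht
    have a2 := wt_nonneg p (max k l) e ht
    have a3 := wt_nonneg p k e ht
    gcongr
    linarith
  · intro t ht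
    have a1 := wt_mono_k (p - 1) (le_max_right k l) e ht
    have a2 := wt_nonneg (p - 1) (max k l) e ht
    have a3 := wt_nonneg (p - 1) l e ht
    rw [mul_div_assoc, wt_div p _ e ht]
    gcongr
    linarith

lemma FS.ode {n j : ℕ} {p : ℝ} {e : ℕ} {g v u : ℝ → ℝ → ℂ} (h0 : FS 0 j p e g)
    (hd : ∀ Δ, 0 < Δ → Δ ≤ 1 / 8 → ∀ t, 0 < t →
      HasDerivAt (g Δ) (v Δ t * g Δ t + u Δ t) t)
    (hv : FS n 0 (-1) 0 v) (hu : FS n j (p - 1) e u) : FS (n + 1) j p e g := by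
  have key : ∀ m, m ≤ n + 1 → FS m j p e g := by
    intro m
    induction m with
    | zero => intro _; exact h0
    | succ m ih =>
      intro hm
      have ihm := ih (by omega)
      refine h0.succ (g' := fun Δ t => v Δ t * g Δ t + u Δ t) hd ?_
      exact ((hv.le (by omega)).mul ihm (by simp) (by ring) (by simp)).add (hu.le (by omega))
  exact key _ le_rfl

lemma abs_one_sub_rpow_neg {Δ t : ℝ} (h1 : 0 < Δ) (h2 : Δ ≤ 1 / 8) (ht : 0 < t) :
    |1 - t ^ (-Δ)| ≤ 8 * Δ * wt (-(1 / 4)) 2 0 t := by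
  have hexp : t ^ (-Δ) = Real.exp (-(Δ * Real.log t)) := by
    rw [Real.rpow_def_of_pos ht]; ring_nf
  rcases le_total 1 t with h | h
  · have hl : 0 ≤ Real.log t := Real.log_nonneg h
    have hlt : Real.log t ≤ t := (Real.log_le_sub_one_of_pos ht).trans (by linarith)
    have e1 := Real.add_one_le_exp (-(Δ * Real.log t))
    have e2 : t ^ (-Δ) ≤ 1 := Real.rpow_le_one_of_one_le_of_nonpos h (by linarith)
    rw [abs_of_nonneg (by linarith)]
    have e3 : t ≤ wt (-(1 / 4)) 2 0 t := by
      unfold wt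
      have : t ^ (1 / 4 : ℝ) ≤ 1 + t := by
        calc t ^ (1 / 4 : ℝ) ≤ t ^ (1 : ℝ) := Real.rpow_le_rpow_of_exponent_le h (by norm_num)
          _ ≤ 1 + t := by rw [Real.rpow_one]; linarith
      have h5 : t = t ^ (-(1 / 4) : ℝ) * (t ^ (1 / 4 : ℝ) * t) := by
        rw [← mul_assoc, ← Real.rpow_add ht]; norm_num
      have h6 : t ^ (1 / 4 : ℝ) * t ≤ (1 + t) ^ 2 := by
        have : t ^ (1 / 4 : ℝ) * t ≤ (1 + t) * t := by gcongr
        nlinarith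
      calc t = t ^ (-(1 / 4) : ℝ) * (t ^ (1 / 4 : ℝ) * t) := h5
        _ ≤ t ^ (-(1 / 4) : ℝ) * (1 + t) ^ 2 := by gcongr
        _ = _ := by simp
    have : Δ * Real.log t ≤ Δ * wt (-(1 / 4)) 2 0 t := by gcongr; linarith
    have := wt_nonneg (-(1 / 4)) 2 0 ht
    nlinarith [mul_nonneg h1.le this]
  · have hl : Real.log t ≤ 0 := Real.log_nonpos ht.le h
    have e2 : 1 ≤ t ^ (-Δ) := Real.one_le_rpow_of_pos_of_le_one_of_nonpos ht h (by linarith)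
    rw [abs_of_nonpos (by linarith)]
    have e1 := Real.add_one_le_exp (Δ * Real.log t)
    have e3 : t ^ (-Δ) * Real.exp (Δ * Real.log t) = 1 := by
      rw [hexp, ← Real.exp_add]; simp
    have e4 : t ^ (-Δ) - 1 ≤ Δ * (-Real.log t) * t ^ (-Δ) := by nlinarith
    have e5 : t ^ (-Δ) ≤ t ^ (-(1 / 8) : ℝ) :=
      Real.rpow_le_rpow_of_exponent_ge ht h (by linarith)
    have e6 := Real.abs_log_mul_self_rpow_lt t (1 / 8) ht h (by norm_num)
    have e7 : -Real.log t * t ^ (1 / 8 : ℝ) ≤ 8 := by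
      have := neg_abs_le (Real.log t * t ^ (1 / 8 : ℝ))
      have h8 : (1 : ℝ) / (1 / 8) = 8 := by norm_num
      rw [h8] at e6
      linarith
    have e8 : -Real.log t ≤ 8 * t ^ (-(1 / 8) : ℝ) := by
      have : -Real.log t = (-Real.log t * t ^ (1 / 8 : ℝ)) * t ^ (-(1 / 8) : ℝ) := by
        rw [mul_assoc, ← Real.rpow_add ht]; norm_num
      rw [this]
      gcongr
    have e9 : t ^ (-(1 / 8) : ℝ) * t ^ (-(1 / 8) : ℝ) = t ^ (-(1 / 4) : ℝ) := by
      rw [← Real.rpow_add ht]; norm_num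
    have e10 : t ^ (-(1 / 4) : ℝ) ≤ wt (-(1 / 4)) 2 0 t := by
      unfold wt
      have : 1 ≤ (1 + t) ^ 2 := one_le_pow₀ (by linarith)
      have h0 := (Real.rpow_pos_of_pos ht (-(1 / 4))).le
      simp only [CharP.cast_eq_zero, zero_mul, neg_zero, Real.exp_zero, mul_one]
      nlinarith
    calc -(1 - t ^ (-Δ)) = t ^ (-Δ) - 1 := by ring
      _ ≤ Δ * (-Real.log t) * t ^ (-Δ) := e4
      _ ≤ Δ * (8 * t ^ (-(1 / 8) : ℝ)) * t ^ (-(1 / 8) : ℝ) := by gcongr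
      _ = 8 * Δ * t ^ (-(1 / 4) : ℝ) := by rw [← e9]; ring
      _ ≤ _ := by gcongr

lemma FS.pow (n j : ℕ) : ∀ (p : ℝ) (a b : ℝ → ℂ) (K : ℝ),
    (∀ Δ, 0 < Δ → Δ ≤ 1 / 8 → ‖a Δ - b Δ‖ ≤ K * Δ ^ j) →
    (∀ Δ, 0 < Δ → Δ ≤ 1 / 8 → Δ * ‖b Δ‖ ≤ K * Δ ^ j) →
    FS n j (p - 1 / 4) 0
      (fun Δ t => a Δ * ((t ^ p : ℝ) : ℂ) - b Δ * ((t ^ (p - Δ) : ℝ) : ℂ)) := by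
  have hder : ∀ (p : ℝ) (a b : ℂ) (Δ t : ℝ), 0 < t →
      HasDerivAt (fun t : ℝ => a * ((t ^ p : ℝ) : ℂ) - b * ((t ^ (p - Δ) : ℝ) : ℂ))
        (a * p * ((t ^ (p - 1) : ℝ) : ℂ) - b * (p - Δ) * ((t ^ (p - 1 - Δ) : ℝ) : ℂ)) t := by
    intro p a b Δ t ht
    have h1 := ((Real.hasDerivAt_rpow_const (p := p) (Or.inl ht.ne')).ofReal_comp).const_mul a
    have h2 := ((Real.hasDerivAt_rpow_const (p := p - Δ) (Or.inl ht.ne')).ofReal_comp).const_mul b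
    refine (h1.sub h2).congr_deriv ?_
    push_cast
    rw [show p - Δ - 1 = p - 1 - Δ by ring]
    ring
  have zero : ∀ (p : ℝ) (a b : ℝ → ℂ) (K : ℝ),
    (∀ Δ, 0 < Δ → Δ ≤ 1 / 8 → ‖a Δ - b Δ‖ ≤ K * Δ ^ j) →
    (∀ Δ, 0 < Δ → Δ ≤ 1 / 8 → Δ * ‖b Δ‖ ≤ K * Δ ^ j) →
    FS 0 j (p - 1 / 4) 0
      (fun Δ t => a Δ * ((t ^ p : ℝ) : ℂ) - b Δ * ((t ^ (p - Δ) : ℝ) : ℂ)) := by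
    intro p a b K ha hb
    have hK : 0 ≤ K := by
      have := (norm_nonneg _).trans (ha (1 / 8) (by norm_num) le_rfl)
      by_contra hc
      have h3 : K * (1 / 8 : ℝ) ^ j < 0 := mul_neg_of_neg_of_pos (by linarith) (by positivity)
      linarith
    refine ⟨9 * K, 2, by positivity, fun Δ h1 h2 => ⟨fun t ht =>
      (hder p _ _ _ t ht).continuousAt.continuousWithinAt, fun t ht => ?_⟩⟩
    have e1 : t ^ (p - Δ) = t ^ p * t ^ (-Δ) := by rw [← Real.rpow_add ht]; ring_nf
    have e2 := abs_one_sub_rpow_neg h1 h2 ht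
    have e3 : a Δ * ((t ^ p : ℝ) : ℂ) - b Δ * ((t ^ (p - Δ) : ℝ) : ℂ)
        = (a Δ - b Δ) * ((t ^ p : ℝ) : ℂ) + b Δ * ((t ^ p * (1 - t ^ (-Δ)) : ℝ) : ℂ) := by
      rw [e1]; push_cast; ring
    have e4 : t ^ p ≤ wt (p - 1 / 4) 2 0 t := by
      have := wt_mono_p (show p - 1 / 4 ≤ p by linarith) 0 0 ht
      have hc : ⌈p - (p - 1 / 4)⌉₊ ≤ 2 := by
        rw [Nat.ceil_le]; norm_num
      have h5 := wt_mono_k (p - 1 / 4) (k := 0 + ⌈p - (p - 1 / 4)⌉₊) (l := 2) (by omega) 0 ht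
      refine le_trans (le_of_eq ?_) (this.trans h5)
      simp [wt]
    have e5 : t ^ p * wt (-(1 / 4)) 2 0 t = wt (p - 1 / 4) 2 0 t := by
      unfold wt
      rw [sub_eq_add_neg, Real.rpow_add ht]; ring
    have a1 := ha Δ h1 h2
    have a2 := hb Δ h1 h2
    have hp := (Real.rpow_pos_of_pos ht p).le
    have hw := wt_nonneg (p - 1 / 4) 2 0 ht
    show ‖a Δ * ((t ^ p : ℝ) : ℂ) - b Δ * ((t ^ (p - Δ) : ℝ) : ℂ)‖ ≤
      9 * K * Δ ^ j * wt (p - 1 / 4) 2 0 t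
    rw [e3]
    refine (norm_add_le _ _).trans ?_
    rw [norm_mul, norm_mul, Complex.norm_real, Complex.norm_real, Real.norm_of_nonneg hp,
      Real.norm_eq_abs, abs_mul, abs_of_nonneg hp]
    calc ‖a Δ - b Δ‖ * t ^ p + ‖b Δ‖ * (t ^ p * |1 - t ^ (-Δ)|)
        ≤ K * Δ ^ j * wt (p - 1 / 4) 2 0 t
          + ‖b Δ‖ * (t ^ p * (8 * Δ * wt (-(1 / 4)) 2 0 t)) := by gcongr
      _ = K * Δ ^ j * wt (p - 1 / 4) 2 0 t
          + 8 * (Δ * ‖b Δ‖) * (t ^ p * wt (-(1 / 4)) 2 0 t) := by ring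
      _ ≤ K * Δ ^ j * wt (p - 1 / 4) 2 0 t
          + 8 * (K * Δ ^ j) * (t ^ p * wt (-(1 / 4)) 2 0 t) := by rw [e5]; gcongr
      _ = _ := by rw [e5]; ring
  induction n with
  | zero => exact zero
  | succ n ih =>
    intro p a b K ha hb
    refine (zero p a b K ha hb).succ (fun Δ h1 h2 t ht => hder p _ _ _ t ht) ?_
    have := ih (p - 1) (fun Δ => a Δ * p) (fun Δ => b Δ * (p - Δ)) ((|p| + 1) * K) ?_ ?_
    · rw [show p - 1 / 4 - 1 = p - 1 - 1 / 4 by ring]; exact this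
    · intro Δ h1 h2
      have e : a Δ * p - b Δ * (p - Δ) = (a Δ - b Δ) * p + b Δ * Δ := by ring
      rw [e]
      refine (norm_add_le _ _).trans ?_
      rw [norm_mul, norm_mul, Complex.norm_real, Complex.norm_real, Real.norm_eq_abs,
        Real.norm_of_nonneg h1.le]
      have a1 := ha Δ h1 h2
      have a2 := hb Δ h1 h2
      nlinarith [mul_le_mul_of_nonneg_right a1 (abs_nonneg p)]
    · intro Δ h1 h2
      have a2 := hb Δ h1 h2
      rw [norm_mul]
      have : ‖(p : ℂ) - Δ‖ ≤ |p| + 1 := by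
        refine (norm_sub_le _ _).trans ?_
        rw [Complex.norm_real, Complex.norm_real, Real.norm_eq_abs, Real.norm_of_nonneg h1.le]
        linarith
      have h0 : 0 ≤ Δ * ‖b Δ‖ := by positivity
      calc Δ * (‖b Δ‖ * ‖(p : ℂ) - Δ‖) = (Δ * ‖b Δ‖) * ‖(p : ℂ) - Δ‖ := by ring
        _ ≤ (K * Δ ^ j) * (|p| + 1) := by gcongr; exact h0.trans a2
        _ = _ := by ring

/-- Half-line Fourier transform. -/
noncomputable def Ft (g : ℝ → ℂ) (x : ℝ) : ℂ :=
  ∫ t in Ioi (0 : ℝ), Complex.exp (-(Complex.I * (t : ℂ) * (x : ℂ))) * g t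

lemma norm_ker (t x : ℝ) : ‖Complex.exp (-(Complex.I * (t : ℂ) * (x : ℂ)))‖ = 1 := by
  rw [Complex.norm_exp]; simp

lemma cont_ker (x : ℝ) :
    Continuous (fun t : ℝ => Complex.exp (-(Complex.I * (t : ℂ) * (x : ℂ)))) := by
  fun_prop

lemma wt_integrable (k : ℕ) : ∀ {p : ℝ}, -1 < p → IntegrableOn (wt p k 1) (Ioi 0) := by
  induction k with
  | zero =>
    intro p hp
    have := Real.GammaIntegral_convergent (s := p + 1) (by linarith)
    refine this.congr_fun (fun t ht => ?_) measurableSet_Ioi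
    simp [wt, mul_comm]
  | succ k ih =>
    intro p hp
    refine ((ih hp).add (ih (p := p + 1) (by linarith))).congr_fun (fun t ht => ?_)
      measurableSet_Ioi
    have ht' : 0 < t := ht
    simp only [Pi.add_apply, wt]
    rw [Real.rpow_add ht', Real.rpow_one]
    ring

lemma SymB.integrableOn {n : ℕ} {g : ℝ → ℂ} {A p : ℝ} {k : ℕ}
    (h : SymB n g (fun t => A * wt p k 1 t)) (hp : -1 < p) : IntegrableOn g (Ioi 0) := by
  refine Integrable.mono' ((wt_integrable k hp).const_mul A)
    (h.cont.aestronglyMeasurable measurableSet_Ioi) ?_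
  filter_upwards [ae_restrict_mem measurableSet_Ioi] with t ht using h.bound t ht

lemma ker_integrableOn {g : ℝ → ℂ} (h : IntegrableOn g (Ioi 0)) (x : ℝ) :
    IntegrableOn (fun t : ℝ => Complex.exp (-(Complex.I * (t : ℂ) * (x : ℂ))) * g t) (Ioi 0) := by
  refine h.norm.mono' ((cont_ker x).aestronglyMeasurable.mul h.aestronglyMeasurable) ?_
  filter_upwards with t
  rw [norm_mul, norm_ker, one_mul]

lemma Ft_add {g h : ℝ → ℂ} (hg : IntegrableOn g (Ioi 0)) (hh : IntegrableOn h (Ioi 0)) (x : ℝ) :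
    Ft (fun t => g t + h t) x = Ft g x + Ft h x := by
  unfold Ft
  rw [← integral_add (ker_integrableOn hg x) (ker_integrableOn hh x)]
  congr 1; ext t; ring

lemma Ft_sub {g h : ℝ → ℂ} (hg : IntegrableOn g (Ioi 0)) (hh : IntegrableOn h (Ioi 0)) (x : ℝ) :
    Ft (fun t => g t - h t) x = Ft g x - Ft h x := by
  unfold Ft
  rw [← integral_sub (ker_integrableOn hg x) (ker_integrableOn hh x)]
  congr 1; ext t; ring

lemma Ft_const_mul (a : ℂ) (g : ℝ → ℂ) (x : ℝ) :
    Ft (fun t => a * g t) x = a * Ft g x := by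
  unfold Ft
  rw [← integral_const_mul]
  congr 1; ext t; ring

lemma Ft_congr {g h : ℝ → ℂ} (hgh : ∀ t, 0 < t → g t = h t) (x : ℝ) : Ft g x = Ft h x := by
  unfold Ft
  refine setIntegral_congr_fun measurableSet_Ioi (fun t ht => ?_)
  rw [hgh t ht]

lemma Ft_parts {g g' : ℝ → ℂ} (hd : ∀ t, 0 < t → HasDerivAt g (g' t) t)
    (hg : IntegrableOn g (Ioi 0)) (hg' : IntegrableOn g' (Ioi 0))
    (h0 : Tendsto g (𝓝[>] 0) (𝓝 0)) (x : ℝ) : Ft g' x = Complex.I * x * Ft g x := by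
  have hk : ∀ t : ℝ, HasDerivAt (fun t : ℝ => Complex.exp (-(Complex.I * (t : ℂ) * (x : ℂ))))
      (Complex.exp (-(Complex.I * (t : ℂ) * (x : ℂ))) * (-(Complex.I * x))) t := by
    intro t
    have h1 : HasDerivAt (fun t : ℝ => -(Complex.I * (t : ℂ) * (x : ℂ))) (-(Complex.I * x)) t := by
      have := (((hasDerivAt_id t).ofReal_comp.const_mul Complex.I).mul_const (x : ℂ)).fun_neg
      refine this.congr_deriv ?_
      simp
    exact h1.cexp
  have hinf : Tendsto g atTop (𝓝 0) :=
    tendsto_zero_of_hasDerivAt_of_integrableOn_Ioi (a := 0) hd hg' hg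
  have zm : ∀ l : Filter ℝ, Tendsto g l (𝓝 0) → Tendsto
      ((fun t : ℝ => Complex.exp (-(Complex.I * (t : ℂ) * (x : ℂ)))) * g) l (𝓝 0) := by
    intro l hl
    rw [tendsto_zero_iff_norm_tendsto_zero] at hl ⊢
    refine hl.congr (fun t => ?_)
    rw [Pi.mul_apply, norm_mul, norm_ker, one_mul]
  have key := integral_Ioi_mul_deriv_eq_deriv_mul (a := (0 : ℝ)) (a' := (0 : ℂ)) (b' := (0 : ℂ))
    (u := fun t : ℝ => Complex.exp (-(Complex.I * (t : ℂ) * (x : ℂ)))) (v := g)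
    (fun t _ => hk t) (fun t ht => hd t ht) (ker_integrableOn hg' x) ?_ (zm _ h0) (zm _ hinf)
  · unfold Ft
    rw [key, ← integral_const_mul, sub_self, zero_sub, ← integral_neg]
    congr 1; ext t; ring
  · have := (ker_integrableOn hg x).const_mul (-(Complex.I * x))
    refine this.congr ?_
    filter_upwards with t
    simp only [Pi.mul_apply]; ring

lemma wt_tendsto {p : ℝ} (hp : 0 < p) (k e : ℕ) : Tendsto (wt p k e) (𝓝[>] 0) (𝓝 0) := by
  have : ContinuousAt (wt p k e) 0 := by
    unfold wt
    refine ContinuousAt.mul (ContinuousAt.mul ?_ (by fun_prop)) (by fun_prop)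
    exact Real.continuousAt_rpow_const 0 p (Or.inr hp.le)
  have h := this.tendsto
  have h0 : wt p k e 0 = 0 := by simp [wt, Real.zero_rpow hp.ne']
  rw [h0] at h
  exact h.mono_left nhdsWithin_le_nhds

lemma SymB.ft {n : ℕ} : ∀ {g : ℝ → ℂ} {A p : ℝ} {k : ℕ},
    SymB n g (fun t => A * wt p k 1 t) → (n : ℝ) < p + 1 → ∀ x : ℝ,
    |x| ^ n * ‖Ft g x‖ ≤ A * ∫ t in Ioi (0 : ℝ), wt (p - n) k 1 t := by
  induction n with
  | zero =>
    intro g A p k h hp x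
    simp only [Nat.cast_zero] at hp
    rw [pow_zero, one_mul, Nat.cast_zero, sub_zero, ← integral_const_mul]
    unfold Ft
    refine norm_integral_le_of_norm_le ((wt_integrable k (by linarith)).const_mul A) ?_
    filter_upwards [ae_restrict_mem measurableSet_Ioi] with t ht
    rw [norm_mul, norm_ker, one_mul]
    exact h.bound t ht
  | succ n ih =>
    intro g A p k h hp x
    push_cast at hp
    have hn : (0 : ℝ) ≤ n := Nat.cast_nonneg n
    have hgi := h.integrableOn (by linarith)
    have hb := h.bound
    obtain ⟨h1, g', h2, h3⟩ := h
    have h4 : SymB n g' (fun t => A * wt (p - 1) k 1 t) := by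
      refine h3.mono fun t ht => le_of_eq ?_
      rw [mul_div_assoc, wt_div p k 1 ht]
    have h5 := h4.integrableOn (by linarith)
    have h0 : Tendsto g (𝓝[>] 0) (𝓝 0) := by
      refine squeeze_zero_norm' (a := fun t => A * wt p k 1 t) ?_ ?_
      · filter_upwards [self_mem_nhdsWithin] with t ht using h1 t ht
      · simpa using (wt_tendsto (p := p) (by linarith) k 1).const_mul A
    have h6 := Ft_parts h2 hgi h5 h0 x
    have h7 := ih h4 (by linarith) x
    rw [h6, norm_mul, norm_mul, Complex.norm_I, Complex.norm_real, Real.norm_eq_abs, one_mul] at h7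
    calc _ = |x| ^ n * (|x| * ‖Ft g x‖) := by ring
      _ ≤ _ := h7
      _ = _ := by push_cast; rw [show p - 1 - (n : ℝ) = p - (n + 1) by ring]

lemma FS.ft {n j : ℕ} {p : ℝ} {g : ℝ → ℝ → ℂ} (h : FS n j p 1 g) (hp : (n : ℝ) < p + 1) :
    ∃ C : ℝ, 0 ≤ C ∧ ∀ Δ, 0 < Δ → Δ ≤ 1 / 8 → ∀ x : ℝ, |x| ^ n * ‖Ft (g Δ) x‖ ≤ C * Δ ^ j := by
  obtain ⟨C, k, hC, H⟩ := h
  refine ⟨C * ∫ t in Ioi (0 : ℝ), wt (p - n) k 1 t, ?_, fun Δ h1 h2 x => ?_⟩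
  · refine mul_nonneg hC (setIntegral_nonneg measurableSet_Ioi fun t ht => wt_nonneg _ _ _ ht)
  · refine ((H Δ h1 h2).ft hp x).trans (le_of_eq ?_)
    ring

lemma FS.integrableOn {n j : ℕ} {p : ℝ} {g : ℝ → ℝ → ℂ} (h : FS n j p 1 g) (hp : -1 < p)
    {Δ : ℝ} (h1 : 0 < Δ) (h2 : Δ ≤ 1 / 8) : IntegrableOn (g Δ) (Ioi 0) := by
  obtain ⟨C, k, hC, H⟩ := h
  exact (H Δ h1 h2).integrableOn hp

/-! Exponential inequalities -/

lemma norm_exp_sub_one_le_max (w : ℂ) :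
    ‖Complex.exp w - 1‖ ≤ ‖w‖ * max 1 (Real.exp w.re) := by
  have hd : ∀ s : ℝ, HasDerivAt (fun s : ℝ => Complex.exp (s * w)) (Complex.exp (s * w) * w) s := by
    intro s
    have h1 : HasDerivAt (fun s : ℝ => (s : ℂ) * w) w s := by
      simpa using (hasDerivAt_id s).ofReal_comp.mul_const w
    exact h1.cexp
  have := norm_image_sub_le_of_norm_deriv_le_segment_01' (f := fun s : ℝ => Complex.exp (s * w))
    (f' := fun s : ℝ => Complex.exp (s * w) * w) (C := ‖w‖ * max 1 (Real.exp w.re))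
    (fun s _ => (hd s).hasDerivWithinAt) ?_
  · simpa using this
  · intro s hs
    rw [norm_mul, Complex.norm_exp, mul_comm]
    gcongr
    rw [Complex.re_ofReal_mul]
    rcases le_total 0 w.re with h | h
    · refine le_max_of_le_right (Real.exp_le_exp.2 ?_)
      nlinarith [hs.1, hs.2]
    · refine le_max_of_le_left (Real.exp_le_one_iff.2 ?_)
      nlinarith [hs.1, hs.2]

lemma norm_exp_sub_one_sub_le_max (w : ℂ) :
    ‖Complex.exp w - 1 - w‖ ≤ ‖w‖ ^ 2 * max 1 (Real.exp w.re) := by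
  have hd : ∀ s : ℝ, HasDerivAt (fun s : ℝ => Complex.exp (s * w) - s * w)
      (Complex.exp (s * w) * w - w) s := by
    intro s
    have h1 : HasDerivAt (fun s : ℝ => (s : ℂ) * w) w s := by
      simpa using (hasDerivAt_id s).ofReal_comp.mul_const w
    exact h1.cexp.sub h1
  have := norm_image_sub_le_of_norm_deriv_le_segment_01'
    (f := fun s : ℝ => Complex.exp (s * w) - s * w)
    (f' := fun s : ℝ => Complex.exp (s * w) * w - w) (C := ‖w‖ ^ 2 * max 1 (Real.exp w.re))
    (fun s _ => (hd s).hasDerivWithinAt) ?_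
  · have e : (fun s : ℝ => Complex.exp (s * w) - s * w) 1
        - (fun s : ℝ => Complex.exp (s * w) - s * w) 0 = Complex.exp w - 1 - w := by
      simp; ring
    rwa [e] at this
  · intro s hs
    have e : Complex.exp (s * w) * w - w = (Complex.exp (s * w) - 1) * w := by ring
    rw [e, norm_mul]
    have h1 := norm_exp_sub_one_le_max (s * w)
    have h2 : ‖(s : ℂ) * w‖ ≤ ‖w‖ := by
      rw [norm_mul, Complex.norm_real, Real.norm_of_nonneg hs.1]
      nlinarith [norm_nonneg w, hs.2]
    have h3 : max 1 (Real.exp ((s : ℂ) * w).re) ≤ max 1 (Real.exp w.re) := by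
      refine max_le (le_max_left _ _) ?_
      rw [Complex.re_ofReal_mul]
      rcases le_total 0 w.re with h | h
      · refine le_max_of_le_right (Real.exp_le_exp.2 ?_)
        nlinarith [hs.1, hs.2]
      · refine le_max_of_le_left (Real.exp_le_one_iff.2 ?_)
        nlinarith [hs.1, hs.2]
    calc _ ≤ (‖w‖ * max 1 (Real.exp w.re)) * ‖w‖ := by
          gcongr
          exact h1.trans (by gcongr)
      _ = _ := by ring

/-- `tan(πΔ/2)`. -/
noncomputable def Tt (Δ : ℝ) : ℝ := Real.tan (Real.pi * Δ / 2)

lemma Tt_bounds {Δ : ℝ} (h1 : 0 < Δ) (h2 : Δ ≤ 1 / 8) : Δ ≤ Tt Δ ∧ Tt Δ ≤ 2 * Δ := by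
  have hpi := Real.pi_gt_three
  have hpi2 := Real.pi_lt_d2
  have hx0 : 0 < Real.pi * Δ / 2 := by positivity
  have hx1 : Real.pi * Δ / 2 ≤ 1 / 5 := by nlinarith
  constructor
  · have := Real.lt_tan hx0 (by linarith)
    unfold Tt
    nlinarith
  · unfold Tt
    rw [Real.tan_eq_sin_div_cos]
    have hc : 1 - (Real.pi * Δ / 2) ^ 2 / 2 ≤ Real.cos (Real.pi * Δ / 2) :=
      Real.one_sub_sq_div_two_le_cos
    have hs := Real.sin_le hx0.le
    have hc2 : 49 / 50 ≤ Real.cos (Real.pi * Δ / 2) := by nlinarith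
    rw [div_le_iff₀ (by linarith)]
    nlinarith

/-- `κ = 1 + iβT`. -/
noncomputable def kap (β Δ : ℝ) : ℂ := 1 + Complex.I * β * (Tt Δ : ℂ)

lemma kap_sub {β Δ : ℝ} (hb : |β| ≤ 1) (h1 : 0 < Δ) (h2 : Δ ≤ 1 / 8) :
    ‖1 - kap β Δ‖ ≤ 2 * Δ := by
  have e : 1 - kap β Δ = -(Complex.I * β * (Tt Δ : ℂ)) := by unfold kap; ring
  obtain ⟨h3, h4⟩ := Tt_bounds h1 h2
  rw [e, norm_neg, norm_mul, norm_mul, Complex.norm_I, Complex.norm_real, Complex.norm_real,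
    Real.norm_eq_abs, Real.norm_of_nonneg (by linarith)]
  nlinarith [abs_nonneg β]

lemma kap_norm {β Δ : ℝ} (hb : |β| ≤ 1) (h1 : 0 < Δ) (h2 : Δ ≤ 1 / 8) :
    ‖kap β Δ‖ ≤ 2 := by
  have e : kap β Δ = 1 - (1 - kap β Δ) := by ring
  rw [e]
  refine (norm_sub_le _ _).trans ?_
  have := kap_sub hb h1 h2
  simp only [norm_one]
  linarith

lemma kap_re (β Δ : ℝ) : (kap β Δ).re = 1 := by simp [kap]

noncomputable def phi (β Δ t : ℝ) : ℂ := Complex.exp (-(kap β Δ * ((t ^ (2 - Δ) : ℝ) : ℂ)))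
noncomputable def ge (t : ℝ) : ℂ := Complex.exp (-((t : ℂ) ^ 2))
noncomputable def ww (β Δ t : ℝ) : ℂ := (t : ℂ) ^ 2 - kap β Δ * ((t ^ (2 - Δ) : ℝ) : ℂ)
noncomputable def ww' (β Δ t : ℝ) : ℂ :=
  2 * (t : ℂ) - kap β Δ * (2 - Δ) * ((t ^ (1 - Δ) : ℝ) : ℂ)
noncomputable def ee (t : ℝ) : ℂ := Complex.exp (-(t : ℂ))
noncomputable def cc (t : ℝ) : ℂ := (1 + (t : ℂ)) * Complex.exp (-(t : ℂ))

lemma phi_eq (β Δ t : ℝ) : phi β Δ t = ge t * Complex.exp (ww β Δ t) := by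
  unfold phi ge ww
  rw [← Complex.exp_add]; congr 1; ring

lemma ofReal_hasDerivAt (t : ℝ) : HasDerivAt (fun t : ℝ => (t : ℂ)) 1 t :=
  (hasDerivAt_id t).ofReal_comp

lemma kpow_hasDerivAt (β Δ : ℝ) {t : ℝ} (ht : 0 < t) :
    HasDerivAt (fun t : ℝ => kap β Δ * ((t ^ (2 - Δ) : ℝ) : ℂ))
      (kap β Δ * (2 - Δ) * ((t ^ (1 - Δ) : ℝ) : ℂ)) t := by
  have h1 := ((Real.hasDerivAt_rpow_const (p := 2 - Δ) (Or.inl ht.ne')).ofReal_comp).const_mul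
    (kap β Δ)
  refine h1.congr_deriv ?_
  rw [show 2 - Δ - 1 = 1 - Δ by ring]
  push_cast; ring

lemma phi_hasDerivAt (β Δ : ℝ) {t : ℝ} (ht : 0 < t) :
    HasDerivAt (phi β Δ) (-(kap β Δ * (2 - Δ) * ((t ^ (1 - Δ) : ℝ) : ℂ)) * phi β Δ t) t := by
  refine ((kpow_hasDerivAt β Δ ht).fun_neg.cexp).congr_deriv ?_
  unfold phi; ring

lemma ge_hasDerivAt (t : ℝ) : HasDerivAt ge (-2 * (t : ℂ) * ge t) t := by
  refine (((ofReal_hasDerivAt t).pow 2).neg.cexp).congr_deriv ?_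
  unfold ge; simp; ring

lemma ee_hasDerivAt (t : ℝ) : HasDerivAt ee (-1 * ee t) t := by
  refine ((ofReal_hasDerivAt t).fun_neg.cexp).congr_deriv ?_
  unfold ee; simp

lemma cc_hasDerivAt (t : ℝ) : HasDerivAt cc (-(t : ℂ) * ee t) t := by
  refine (((ofReal_hasDerivAt t).const_add 1).mul (ee_hasDerivAt t)).congr_deriv ?_
  unfold ee; simp; ring

lemma ww_hasDerivAt (β Δ : ℝ) {t : ℝ} (ht : 0 < t) :
    HasDerivAt (ww β Δ) (ww' β Δ t) t := by
  refine (((ofReal_hasDerivAt t).pow 2).sub (kpow_hasDerivAt β Δ ht)).congr_deriv ?_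
  unfold ww'; simp

lemma FS.cpow (n : ℕ) (p : ℝ) (c : ℂ) :
    FS n 0 (p - 1 / 4) 0 (fun _ t => c * ((t ^ p : ℝ) : ℂ)) := by
  refine (FS.pow n 0 p (fun _ => c) (fun _ => 0) ‖c‖ ?_ ?_).congr ?_
  · intro Δ h1 h2; simp
  · intro Δ h1 h2; simp
  · intro Δ h1 h2 t ht; simp

lemma FS.const (n : ℕ) (c : ℂ) : FS n 0 (-1) 0 (fun _ _ => c) := by
  refine ((FS.cpow n 0 c).congr ?_).mono_p (by norm_num)
  intro Δ h1 h2 t ht; simp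

lemma FS.idm (n : ℕ) (c : ℂ) : FS n 0 (3 / 4) 0 (fun _ t => c * (t : ℂ)) := by
  refine ((FS.cpow n 1 c).congr ?_).mono_p (by norm_num)
  intro Δ h1 h2 t ht; simp

lemma FS.sqm (n : ℕ) (c : ℂ) : FS n 0 (7 / 4) 0 (fun _ t => c * (t : ℂ) ^ 2) := by
  refine ((FS.cpow n 2 c).congr ?_).mono_p (by norm_num)
  intro Δ h1 h2 t ht; simp

lemma FS.ww (n : ℕ) {β : ℝ} (hb : |β| ≤ 1) : FS n 1 (7 / 4) 0 (ww β) := by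
  refine ((FS.pow n 1 2 (fun _ => 1) (kap β) 2 ?_ ?_).congr ?_).mono_p (by norm_num)
  · intro Δ h1 h2; simpa using kap_sub hb h1 h2
  · intro Δ h1 h2
    have := kap_norm hb h1 h2
    rw [pow_one]; nlinarith
  · intro Δ h1 h2 t ht; simp [_root_.ww]

lemma FS.ww' (n : ℕ) {β : ℝ} (hb : |β| ≤ 1) : FS n 1 (3 / 4) 0 (ww' β) := by
  refine ((FS.pow n 1 1 (fun _ => 2) (fun Δ => kap β Δ * (2 - Δ)) 8 ?_ ?_).congr ?_).mono_p
    (by norm_num)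
  · intro Δ h1 h2
    have e : 2 - kap β Δ * (2 - Δ) = 2 * (1 - kap β Δ) + kap β Δ * Δ := by ring
    rw [e]
    refine (norm_add_le _ _).trans ?_
    rw [norm_mul, norm_mul, Complex.norm_real, Real.norm_of_nonneg h1.le, pow_one]
    have := kap_norm hb h1 h2
    have := kap_sub hb h1 h2
    simp only [Complex.norm_ofNat]
    nlinarith
  · intro Δ h1 h2
    have := kap_norm hb h1 h2
    rw [norm_mul]
    have : ‖(2 : ℂ) - Δ‖ ≤ 3 := by
      refine (norm_sub_le _ _).trans ?_
      rw [Complex.norm_real, Real.norm_of_nonneg h1.le]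
      simp only [Complex.norm_ofNat]; linarith
    have : ‖kap β Δ‖ * ‖(2 : ℂ) - Δ‖ ≤ 2 * 3 := by gcongr
    rw [pow_one]
    nlinarith
  · intro Δ h1 h2 t ht; simp [_root_.ww']

lemma FS.kp (n : ℕ) {β : ℝ} (hb : |β| ≤ 1) : FS n 0 (3 / 4) 0
    (fun Δ t => -(kap β Δ * (2 - Δ) * ((t ^ (1 - Δ) : ℝ) : ℂ))) := by
  refine ((((FS.ww' n hb).mono_j (Nat.zero_le 1)).add (FS.idm n (-2)))).congr ?_
  intro Δ h1 h2 t ht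
  simp only [_root_.ww']; ring

lemma FS.zero_exp {j : ℕ} {p : ℝ} {g h : ℝ → ℝ → ℂ} (hh : FS 0 j p 0 h) (K : ℝ) (hK : 0 ≤ K)
    (hc : ∀ Δ, 0 < Δ → Δ ≤ 1 / 8 → ContinuousOn (g Δ) (Ioi 0))
    (hle : ∀ Δ, 0 < Δ → Δ ≤ 1 / 8 → ∀ t, 0 < t → ‖g Δ t‖ ≤ K * Real.exp (-t) * ‖h Δ t‖) :
    FS 0 j p 1 g := by
  obtain ⟨C, k, hC, H⟩ := hh
  refine ⟨K * C, k, by positivity, fun Δ h1 h2 => ⟨hc Δ h1 h2, fun t ht => ?_⟩⟩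
  refine (hle Δ h1 h2 t ht).trans ?_
  have := (H Δ h1 h2).bound t ht
  calc _ ≤ K * Real.exp (-t) * (C * Δ ^ j * wt p k 0 t) := by gcongr
    _ = _ := by simp [wt]; ring

lemma rpow_ge_sub {a t : ℝ} (ha : 1 ≤ a) (ht : 0 < t) : t - 1 ≤ t ^ a := by
  rcases le_total 1 t with h | h
  · have := Real.rpow_le_rpow_of_exponent_le h ha
    rw [Real.rpow_one] at this; linarith
  · have := Real.rpow_pos_of_pos ht a; linarith

lemma norm_phi (β Δ : ℝ) {t : ℝ} : ‖phi β Δ t‖ = Real.exp (-(t ^ (2 - Δ))) := by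
  unfold phi
  rw [Complex.norm_exp, Complex.neg_re, Complex.re_mul_ofReal, kap_re, one_mul]

lemma norm_phi_le (β : ℝ) {Δ t : ℝ} (h2 : Δ ≤ 1 / 8) (ht : 0 < t) :
    ‖phi β Δ t‖ ≤ 3 * Real.exp (-t) := by
  rw [norm_phi]
  have := rpow_ge_sub (a := 2 - Δ) (by linarith) ht
  calc _ ≤ Real.exp (1 + -t) := Real.exp_le_exp.2 (by linarith)
    _ = Real.exp 1 * Real.exp (-t) := Real.exp_add _ _
    _ ≤ _ := by gcongr; linarith [Real.exp_one_lt_d9]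

lemma norm_ge (t : ℝ) : ‖ge t‖ = Real.exp (-t ^ 2) := by
  unfold ge
  rw [← Complex.ofReal_pow, ← Complex.ofReal_neg, Complex.norm_exp, Complex.ofReal_re]

lemma norm_ge_le (t : ℝ) : ‖ge t‖ ≤ 3 * Real.exp (-t) := by
  rw [norm_ge]
  calc _ ≤ Real.exp (1 + -t) := Real.exp_le_exp.2 (by nlinarith [sq_nonneg (t - 1/2)])
    _ = Real.exp 1 * Real.exp (-t) := Real.exp_add _ _
    _ ≤ _ := by gcongr; linarith [Real.exp_one_lt_d9]

lemma contOn_of_deriv {g g' : ℝ → ℂ} (h : ∀ t, 0 < t → HasDerivAt g (g' t) t) :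
    ContinuousOn g (Ioi 0) := fun t ht => (h t ht).continuousAt.continuousWithinAt

lemma FS.zero (n j : ℕ) (p : ℝ) (e : ℕ) : FS n j p e (fun _ _ => 0) := by
  refine ⟨0, 0, le_rfl, fun Δ h1 h2 => ?_⟩
  have : ∀ m : ℕ, ∀ b : ℝ → ℝ, (∀ t, 0 < t → 0 ≤ b t) → SymB m (fun _ => 0) b := by
    intro m
    induction m with
    | zero => intro b hb; exact ⟨continuousOn_const, fun t ht => by simpa using hb t ht⟩
    | succ m ih =>
      intro b hb
      refine ⟨fun t ht => by simpa using hb t ht, fun _ => 0, fun t ht => hasDerivAt_const _ _,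
        ih _ fun t ht => div_nonneg (hb t ht) ht.le⟩
  exact this _ _ (fun t ht => by simp)

lemma FS.one0 : FS 0 0 0 0 (fun _ _ => (1 : ℂ)) := by
  refine ⟨1, 0, by norm_num, fun Δ h1 h2 => ⟨continuousOn_const, fun t ht => ?_⟩⟩
  simp [wt]

lemma FS.phi (n : ℕ) {β : ℝ} (hb : |β| ≤ 1) : FS n 0 0 1 (phi β) := by
  have h0 : FS 0 0 0 1 (_root_.phi β) := FS.zero_exp FS.one0 3 (by norm_num)
    (fun Δ h1 h2 => contOn_of_deriv fun t ht => phi_hasDerivAt β Δ ht)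
    (fun Δ h1 h2 t ht => by simpa using norm_phi_le β h2 ht)
  refine (FS.ode (n := n) h0 (u := fun _ _ => 0) (fun Δ h1 h2 t ht => ?_)
    ((FS.kp n hb).mono_p (by norm_num)) (FS.zero _ _ _ _)).le (Nat.le_succ n)
  simpa using phi_hasDerivAt β Δ ht

lemma FS.ge (n : ℕ) : FS n 0 0 1 (fun _ => ge) := by
  have h0 : FS 0 0 0 1 (fun _ => _root_.ge) := FS.zero_exp FS.one0 3 (by norm_num)
    (fun Δ h1 h2 => contOn_of_deriv fun t ht => ge_hasDerivAt t)
    (fun Δ h1 h2 t ht => by simpa using norm_ge_le t)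
  refine (FS.ode (n := n) h0 (u := fun _ _ => 0) (v := fun _ t => -2 * (t : ℂ))
    (fun Δ h1 h2 t ht => ?_)
    ((FS.idm n _).mono_p (by norm_num)) (FS.zero _ _ _ _)).le (Nat.le_succ n)
  simpa using ge_hasDerivAt t

lemma norm_ee (t : ℝ) : ‖ee t‖ = Real.exp (-t) := by
  unfold ee
  rw [← Complex.ofReal_neg, Complex.norm_exp, Complex.ofReal_re]

lemma FS.ee (n : ℕ) : FS n 0 0 1 (fun _ => ee) := by
  have h0 : FS 0 0 0 1 (fun _ => _root_.ee) := FS.zero_exp FS.one0 1 (by norm_num)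
    (fun Δ h1 h2 => contOn_of_deriv fun t ht => ee_hasDerivAt t)
    (fun Δ h1 h2 t ht => by simp [norm_ee])
  refine (FS.ode (n := n) h0 (u := fun _ _ => 0) (v := fun _ t => -1)
    (fun Δ h1 h2 t ht => ?_)
    (FS.const n _) (FS.zero _ _ _ _)).le (Nat.le_succ n)
  simpa using ee_hasDerivAt t

lemma ge_max {β Δ t : ℝ} (h2 : Δ ≤ 1 / 8) (ht : 0 < t) :
    ‖ge t‖ * max 1 (Real.exp (ww β Δ t).re) ≤ 3 * Real.exp (-t) := by
  have : Real.exp (ww β Δ t).re = ‖Complex.exp (ww β Δ t)‖ := (Complex.norm_exp _).symm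
  rw [mul_max_of_nonneg _ _ (norm_nonneg _), this, ← norm_mul, ← phi_eq, mul_one]
  exact max_le (norm_ge_le t) (norm_phi_le β h2 ht)

/-- `ρ = φ₀ - e^{-t²}`. -/
noncomputable def rho (β Δ t : ℝ) : ℂ := phi β Δ t - ge t

lemma rho_hasDerivAt (β Δ : ℝ) {t : ℝ} (ht : 0 < t) :
    HasDerivAt (rho β Δ) (-2 * (t : ℂ) * rho β Δ t + ww' β Δ t * phi β Δ t) t := by
  refine ((phi_hasDerivAt β Δ ht).sub (ge_hasDerivAt t)).congr_deriv ?_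
  unfold rho ww'; ring

lemma FS.rho (n : ℕ) {β : ℝ} (hb : |β| ≤ 1) : FS n 1 (7 / 4) 1 (rho β) := by
  have h0 : FS 0 1 (7 / 4) 1 (_root_.rho β) := by
    refine FS.zero_exp (FS.ww 0 hb) 3 (by norm_num)
      (fun Δ h1 h2 => contOn_of_deriv fun t ht => rho_hasDerivAt β Δ ht) fun Δ h1 h2 t ht => ?_
    have e : _root_.rho β Δ t = _root_.ge t * (Complex.exp (_root_.ww β Δ t) - 1) := by
      unfold _root_.rho; rw [phi_eq]; ring
    rw [e, norm_mul]
    calc _ ≤ ‖_root_.ge t‖ * (‖_root_.ww β Δ t‖ * max 1 (Real.exp (_root_.ww β Δ t).re)) := by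
          gcongr; exact norm_exp_sub_one_le_max _
      _ = (‖_root_.ge t‖ * max 1 (Real.exp (_root_.ww β Δ t).re)) * ‖_root_.ww β Δ t‖ := by ring
      _ ≤ _ := mul_le_mul_of_nonneg_right (ge_max h2 ht) (by positivity)
  exact (FS.ode (n := n) h0 (fun Δ h1 h2 t ht => rho_hasDerivAt β Δ ht)
    ((FS.idm n _).mono_p (by norm_num))
    ((FS.ww' n hb).mul (FS.phi n hb) rfl (by norm_num) rfl)).le (Nat.le_succ n)

/-- `S = ρ - w e^{-t²}`. -/
noncomputable def Ss (β Δ t : ℝ) : ℂ := rho β Δ t - ww β Δ t * ge t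

lemma Ss_hasDerivAt (β Δ : ℝ) {t : ℝ} (ht : 0 < t) :
    HasDerivAt (Ss β Δ) (-2 * (t : ℂ) * Ss β Δ t + ww' β Δ t * rho β Δ t) t := by
  refine ((rho_hasDerivAt β Δ ht).sub
    ((ww_hasDerivAt β Δ ht).mul (ge_hasDerivAt t))).congr_deriv ?_
  unfold Ss rho; ring

lemma FS.Ss (n : ℕ) {β : ℝ} (hb : |β| ≤ 1) : FS n 2 (7 / 2) 1 (Ss β) := by
  have h0 : FS 0 2 (7 / 2) 1 (_root_.Ss β) := by
    refine FS.zero_exp ((FS.ww 0 hb).mul (FS.ww 0 hb) rfl (by norm_num) rfl) 3 (by norm_num)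
      (fun Δ h1 h2 => contOn_of_deriv fun t ht => Ss_hasDerivAt β Δ ht) fun Δ h1 h2 t ht => ?_
    have e : _root_.Ss β Δ t = _root_.ge t * (Complex.exp (_root_.ww β Δ t) - 1
        - _root_.ww β Δ t) := by
      unfold _root_.Ss _root_.rho; rw [phi_eq]; ring
    rw [e, norm_mul, norm_mul]
    calc _ ≤ ‖_root_.ge t‖ * (‖_root_.ww β Δ t‖ ^ 2 * max 1 (Real.exp (_root_.ww β Δ t).re)) := by
          gcongr; exact norm_exp_sub_one_sub_le_max _
      _ = (‖_root_.ge t‖ * max 1 (Real.exp (_root_.ww β Δ t).re)) *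
          (‖_root_.ww β Δ t‖ * ‖_root_.ww β Δ t‖) := by ring
      _ ≤ _ := mul_le_mul_of_nonneg_right (ge_max h2 ht) (by positivity)
  exact (FS.ode (n := n) h0 (fun Δ h1 h2 t ht => Ss_hasDerivAt β Δ ht)
    ((FS.idm n _).mono_p (by norm_num))
    ((FS.ww' n hb).mul (FS.rho n hb) rfl (by norm_num) rfl)).le (Nat.le_succ n)

/-- `d = e^{-t²} - (1+t)e^{-t}`. -/
noncomputable def dd (t : ℝ) : ℂ := ge t - cc t

lemma dd_hasDerivAt (t : ℝ) :
    HasDerivAt dd (-2 * (t : ℂ) * dd t + (-1 * (t : ℂ) + -2 * (t : ℂ) ^ 2) * ee t) t := by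
  refine ((ge_hasDerivAt t).sub (cc_hasDerivAt t)).congr_deriv ?_
  unfold dd cc ee; ring

lemma norm_dd_le {t : ℝ} (ht : 0 < t) : ‖dd t‖ ≤ 6 * Real.exp (-t) * t ^ 2 := by
  have e : dd t = ((Real.exp (-t ^ 2) - (1 + t) * Real.exp (-t) : ℝ) : ℂ) := by
    unfold dd ge cc; push_cast; ring_nf
  rw [e, Complex.norm_real, Real.norm_eq_abs]
  rcases le_total t 1 with h | h
  · have a1 := Real.add_one_le_exp (-t ^ 2)
    have a2 : Real.exp (-t ^ 2) ≤ 1 := Real.exp_le_one_iff.2 (by nlinarith)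
    have a3 := Real.add_one_le_exp (-t)
    have a4 := Real.add_one_le_exp t
    have a5 : Real.exp t * Real.exp (-t) = 1 := by rw [← Real.exp_add]; simp
    have a6 : 0 < Real.exp (-t) := Real.exp_pos _
    have a7 : Real.exp (-1) ≤ Real.exp (-t) := Real.exp_le_exp.2 (by linarith)
    have a8 := Real.exp_neg_one_gt_d9
    have a9 : |Real.exp (-t ^ 2) - (1 + t) * Real.exp (-t)| ≤ t ^ 2 := by
      rw [abs_le]; constructor <;> nlinarith
    nlinarith [sq_nonneg t]
  · have b1 := norm_ge_le t
    rw [norm_ge] at b1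
    have a6 : 0 < Real.exp (-t) := Real.exp_pos _
    have a7 : 0 < Real.exp (-t ^ 2) := Real.exp_pos _
    rw [abs_le]
    have : 1 + t ≤ 2 * t ^ 2 := by nlinarith
    have : 3 ≤ 3 * t ^ 2 := by nlinarith
    constructor <;> nlinarith

lemma FS.dd (n : ℕ) : FS n 0 (7 / 4) 1 (fun _ => dd) := by
  have h0 : FS 0 0 (7 / 4) 1 (fun _ => _root_.dd) := by
    refine FS.zero_exp (FS.sqm 0 1) 6 (by norm_num)
      (fun Δ h1 h2 => contOn_of_deriv fun t ht => dd_hasDerivAt t) fun Δ h1 h2 t ht => ?_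
    simpa using norm_dd_le ht
  exact (FS.ode (n := n) h0 (fun Δ h1 h2 t ht => dd_hasDerivAt t)
    ((FS.idm n _).mono_p (by norm_num))
    (((FS.idm n _).add ((FS.sqm n _).mono_p (by norm_num))).mul (FS.ee n) rfl (by norm_num) rfl)).le
    (Nat.le_succ n)

/-- `i (t - t^α)` -/
noncomputable def qq (Δ t : ℝ) : ℂ := Complex.I * ((t - t ^ (2 - Δ) : ℝ) : ℂ)

lemma FS.qq (n : ℕ) : FS n 0 (3 / 4) 0 qq := by
  refine ((FS.idm n Complex.I).add ((FS.pow n 0 2 (fun _ => 0) (fun _ => Complex.I) 1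
    (fun Δ h1 h2 => by simp) (fun Δ h1 h2 => by simp; linarith)).mono_p (by norm_num))).congr ?_
  intro Δ h1 h2 t ht
  simp only [_root_.qq]; push_cast; ring

lemma FS.qphi (n : ℕ) {β : ℝ} (hb : |β| ≤ 1) :
    FS n 0 (3 / 4) 1 (fun Δ t => _root_.qq Δ t * _root_.phi β Δ t) :=
  (FS.qq n).mul (FS.phi n hb) rfl (by norm_num) rfl

lemma FS.r2 (n : ℕ) {β : ℝ} (hb : |β| ≤ 1) :
    FS n 0 (5 / 2) 1 (fun Δ t => _root_.qq Δ t * (_root_.phi β Δ t - cc t)) := by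
  refine (FS.qq n).mul (((FS.rho n hb).mono_j (Nat.zero_le 1)).add (FS.dd n) |>.congr ?_) rfl
    (by norm_num) rfl
  intro Δ h1 h2 t ht
  simp only [_root_.rho, _root_.dd]; ring

lemma FS.trho (n : ℕ) {β : ℝ} (hb : |β| ≤ 1) :
    FS n 1 (5 / 2) 1 (fun Δ t => -Complex.I * (t : ℂ) * _root_.rho β Δ t) :=
  (FS.idm n (-Complex.I)).mul (FS.rho n hb) rfl (by norm_num) rfl

lemma FS.wd (n : ℕ) {β : ℝ} (hb : |β| ≤ 1) :
    FS n 1 (7 / 2) 1 (fun Δ t => _root_.ww β Δ t * _root_.dd t) :=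
  (FS.ww n hb).mul (FS.dd n) rfl (by norm_num) rfl

lemma ker_hasDerivAt (t x : ℝ) :
    HasDerivAt (fun x : ℝ => Complex.exp (-(Complex.I * (t : ℂ) * (x : ℂ))))
      (Complex.exp (-(Complex.I * (t : ℂ) * (x : ℂ))) * (-Complex.I * t)) x := by
  have h1 := ((ofReal_hasDerivAt x).const_mul (Complex.I * (t : ℂ))).fun_neg
  refine h1.cexp.congr_deriv ?_
  ring

lemma Ft_hasDerivAt {g : ℝ → ℂ} (hg : IntegrableOn g (Ioi 0))
    (htg : IntegrableOn (fun t : ℝ => -Complex.I * (t : ℂ) * g t) (Ioi 0)) (x : ℝ) :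
    HasDerivAt (Ft g) (Ft (fun t : ℝ => -Complex.I * (t : ℂ) * g t) x) x := by
  refine (hasDerivAt_integral_of_dominated_loc_of_deriv_le (s := univ)
    (bound := fun t : ℝ => ‖-Complex.I * (t : ℂ) * g t‖)
    (μ := volume.restrict (Ioi 0))
    (F := fun (x : ℝ) (t : ℝ) => Complex.exp (-(Complex.I * (t : ℂ) * (x : ℂ))) * g t)
    (F' := fun (x : ℝ) (t : ℝ) => Complex.exp (-(Complex.I * (t : ℂ) * (x : ℂ))) *
      (-Complex.I * (t : ℂ) * g t)) univ_mem
    (Eventually.of_forall fun x => (ker_integrableOn hg x).aestronglyMeasurable)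
    (ker_integrableOn hg x) (ker_integrableOn htg x).aestronglyMeasurable
    ?_ htg.norm ?_).2
  · refine Eventually.of_forall fun t x _ => ?_
    rw [norm_mul, norm_ker, one_mul]
  · refine Eventually.of_forall fun t x _ => ?_
    refine ((ker_hasDerivAt t x).mul_const (g t)).congr_deriv ?_
    ring

lemma re_hasDerivAt {F : ℝ → ℂ} {F' : ℂ} {x : ℝ} (h : HasDerivAt F F' x) (a : ℝ) :
    HasDerivAt (fun x => a * (F x).re) (a * F'.re) x := by
  have := (Complex.reCLM.hasFDerivAt.comp_hasDerivAt x h).const_mul a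
  exact this

/-- centred density -/
noncomputable def hD (β Δ y : ℝ) : ℝ := (1 / Real.pi) * (Ft (phi β Δ) y).re

lemma phi_int (β : ℝ) {Δ : ℝ} (hb : |β| ≤ 1) (h1 : 0 < Δ) (h2 : Δ ≤ 1 / 8) :
    IntegrableOn (phi β Δ) (Ioi 0) := (FS.phi 0 hb).integrableOn (by norm_num) h1 h2

lemma tphi_int (β : ℝ) {Δ : ℝ} (hb : |β| ≤ 1) (h1 : 0 < Δ) (h2 : Δ ≤ 1 / 8) :
    IntegrableOn (fun t : ℝ => -Complex.I * (t : ℂ) * phi β Δ t) (Ioi 0) :=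
  ((FS.idm 0 (-Complex.I)).mul (FS.phi 0 hb) (j := 0) rfl rfl (e := 1) rfl).integrableOn
    (by norm_num) h1 h2

lemma qphi_int (β : ℝ) {Δ : ℝ} (hb : |β| ≤ 1) (h1 : 0 < Δ) (h2 : Δ ≤ 1 / 8) :
    IntegrableOn (fun t : ℝ => qq Δ t * phi β Δ t) (Ioi 0) :=
  (FS.qphi 0 hb).integrableOn (by norm_num) h1 h2

lemma tan_shift (Δ : ℝ) : Real.tan (Real.pi * (2 - Δ) / 2) = -Tt Δ := by
  unfold Tt
  rw [show Real.pi * (2 - Δ) / 2 = Real.pi - Real.pi * Δ / 2 by ring, Real.tan_pi_sub]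

lemma ker_phi (b Δ x t : ℝ) :
    Complex.exp (-(Complex.I * (t : ℂ) * ((x - b * Tt Δ : ℝ) : ℂ))) * phi b Δ t
    = Complex.exp (-(Complex.I * (t : ℂ) * (x : ℂ))) *
      (phi 0 Δ t * Complex.exp ((b : ℂ) * (Tt Δ * qq Δ t))) := by
  unfold phi qq kap
  rw [← Complex.exp_add, ← Complex.exp_add, ← Complex.exp_add]
  congr 1
  push_cast
  ring

lemma sd_eq' (b Δ x : ℝ) : stableDensity (2 - Δ) b x
    = (1 / Real.pi) * (∫ t in Ioi (0 : ℝ), Complex.exp (-(Complex.I * (t : ℂ) * (x : ℂ))) *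
      (phi 0 Δ t * Complex.exp ((b : ℂ) * (Tt Δ * qq Δ t)))).re := by
  unfold stableDensity
  congr 2
  refine setIntegral_congr_fun measurableSet_Ioi (fun t ht => ?_)
  have ht' : 0 < t := ht
  show _ = Complex.exp (-(Complex.I * (t : ℂ) * (x : ℂ))) *
      (phi 0 Δ t * Complex.exp ((b : ℂ) * (Tt Δ * qq Δ t)))
  congr 1
  unfold phi qq kap
  rw [← Complex.exp_add, tan_shift]
  congr 1
  have e : t ^ (2 - Δ) * t ^ (1 - (2 - Δ)) = t := by
    rw [← Real.rpow_add ht']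
    rw [show (2 - Δ + (1 - (2 - Δ))) = 1 by ring, Real.rpow_one]
  have e' : ((t ^ (2 - Δ) : ℝ) : ℂ) * ((t ^ (1 - (2 - Δ)) : ℝ) : ℂ) = t := by
    rw [← Complex.ofReal_mul, e]
  push_cast
  linear_combination (Complex.I * b * (Tt Δ : ℂ)) * e'

lemma sd_eq (b Δ x : ℝ) : stableDensity (2 - Δ) b x = hD b Δ (x - b * Tt Δ) := by
  rw [sd_eq', hD, Ft]
  simp_rw [ker_phi]

lemma hD_hasDerivAt (β : ℝ) {Δ : ℝ} (hb : |β| ≤ 1) (h1 : 0 < Δ) (h2 : Δ ≤ 1 / 8) (y : ℝ) :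
    HasDerivAt (hD β Δ)
      ((1 / Real.pi) * (Ft (fun t : ℝ => -Complex.I * (t : ℂ) * phi β Δ t) y).re) y :=
  re_hasDerivAt (Ft_hasDerivAt (phi_int β hb h1 h2) (tphi_int β hb h1 h2) y) _

lemma fX_eq (β : ℝ) {Δ : ℝ} (hb : |β| ≤ 1) (h1 : 0 < Δ) (h2 : Δ ≤ 1 / 8) (x : ℝ) :
    fX (2 - Δ) β x = (1 / Real.pi) *
      (Ft (fun t : ℝ => -Complex.I * (t : ℂ) * phi β Δ t) (x - β * Tt Δ)).re := by
  unfold fX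
  have : stableDensity (2 - Δ) β = fun x => hD β Δ (x - β * Tt Δ) := by
    ext x; exact sd_eq β Δ x
  rw [this]
  exact ((hD_hasDerivAt β hb h1 h2 (x - β * Tt Δ)).comp_sub_const x (β * Tt Δ)).deriv

lemma norm_psi (b Δ t : ℝ) :
    ‖phi 0 Δ t * Complex.exp ((b : ℂ) * (Tt Δ * qq Δ t))‖ = ‖phi 0 Δ t‖ := by
  have : (b : ℂ) * (Tt Δ * qq Δ t) = ((b * (Tt Δ * (t - t ^ (2 - Δ))) : ℝ) : ℂ) * Complex.I := by
    unfold qq; push_cast; ring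
  rw [norm_mul, this, Complex.norm_exp_ofReal_mul_I, mul_one]

lemma qq_contOn (Δ : ℝ) : ContinuousOn (qq Δ) (Ioi 0) := by
  unfold qq
  refine continuousOn_const.mul (Complex.continuous_ofReal.comp_continuousOn
    (continuousOn_id.sub ?_))
  intro t ht
  exact (Real.continuousAt_rpow_const t _ (Or.inl (ne_of_gt ht))).continuousWithinAt

lemma psi_int (b : ℝ) {Δ : ℝ} (h1 : 0 < Δ) (h2 : Δ ≤ 1 / 8) :
    IntegrableOn (fun t => phi 0 Δ t * Complex.exp ((b : ℂ) * (Tt Δ * qq Δ t))) (Ioi 0) := by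
  have h := phi_int 0 (by simp) h1 h2
  refine h.norm.mono' (h.aestronglyMeasurable.mul ?_) ?_
  · refine ContinuousOn.aestronglyMeasurable ?_ measurableSet_Ioi
    exact (continuousOn_const.mul (continuousOn_const.mul (qq_contOn Δ))).cexp
  · exact Eventually.of_forall fun t => (norm_psi b Δ t).le

lemma qpsi_int (b : ℝ) {Δ : ℝ} (h1 : 0 < Δ) (h2 : Δ ≤ 1 / 8) :
    IntegrableOn (fun t => qq Δ t * (phi 0 Δ t * Complex.exp ((b : ℂ) * (Tt Δ * qq Δ t))))
      (Ioi 0) := by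
  have h := qphi_int 0 (by simp) h1 h2
  refine h.norm.mono' (((qq_contOn Δ).aestronglyMeasurable measurableSet_Ioi).mul
    (psi_int b h1 h2).aestronglyMeasurable) ?_
  refine Eventually.of_forall fun t => ?_
  rw [norm_mul, norm_psi, norm_mul]

lemma fBeta_eq' (β : ℝ) {Δ : ℝ} (h1 : 0 < Δ) (h2 : Δ ≤ 1 / 8) (x : ℝ) :
    fBeta (2 - Δ) β x = (Tt Δ / Real.pi) *
      (Ft (fun t => qq Δ t * (phi 0 Δ t * Complex.exp ((β : ℂ) * (Tt Δ * qq Δ t)))) x).re := by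
  unfold fBeta
  simp_rw [sd_eq']
  have key := (hasDerivAt_integral_of_dominated_loc_of_deriv_le (s := univ) (x₀ := β)
    (μ := volume.restrict (Ioi 0))
    (F := fun (b : ℝ) (t : ℝ) => Complex.exp (-(Complex.I * (t : ℂ) * (x : ℂ))) *
      (phi 0 Δ t * Complex.exp ((b : ℂ) * (Tt Δ * qq Δ t))))
    (F' := fun (b : ℝ) (t : ℝ) => Complex.exp (-(Complex.I * (t : ℂ) * (x : ℂ))) *
      (Tt Δ * (qq Δ t * (phi 0 Δ t * Complex.exp ((b : ℂ) * (Tt Δ * qq Δ t))))))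
    (bound := fun t => ‖(Tt Δ : ℂ) * (qq Δ t * phi 0 Δ t)‖) univ_mem
    (Eventually.of_forall fun b => (ker_integrableOn (psi_int b h1 h2) x).aestronglyMeasurable)
    (ker_integrableOn (psi_int β h1 h2) x)
    (ker_integrableOn ((qpsi_int β h1 h2).const_mul _) x).aestronglyMeasurable
    ?_ ((qphi_int 0 (by simp) h1 h2).const_mul _).norm ?_).2
  · rw [(re_hasDerivAt key (1 / Real.pi)).deriv]
    have := Ft_const_mul (Tt Δ : ℂ)
      (fun t => qq Δ t * (phi 0 Δ t * Complex.exp ((β : ℂ) * (Tt Δ * qq Δ t)))) x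
    unfold Ft at this ⊢
    rw [this, Complex.re_ofReal_mul]
    ring
  · refine Eventually.of_forall fun t b _ => ?_
    rw [norm_mul, norm_ker, one_mul, norm_mul, norm_mul, norm_psi, norm_mul, norm_mul]
  · refine Eventually.of_forall fun t b _ => ?_
    have := (((ofReal_hasDerivAt b).mul_const ((Tt Δ : ℂ) * qq Δ t)).cexp.const_mul
      (phi 0 Δ t)).const_mul (Complex.exp (-(Complex.I * (t : ℂ) * (x : ℂ))))
    refine this.congr_deriv ?_
    ring

lemma fBeta_eq (β : ℝ) {Δ : ℝ} (h1 : 0 < Δ) (h2 : Δ ≤ 1 / 8) (x : ℝ) :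
    fBeta (2 - Δ) β x = (Tt Δ / Real.pi) *
      (Ft (fun t => qq Δ t * phi β Δ t) (x - β * Tt Δ)).re := by
  rw [fBeta_eq' β h1 h2]
  congr 2
  unfold Ft
  congr 1; ext t
  have := ker_phi β Δ x t
  linear_combination -(qq Δ t) * this

/-- G -/
lemma ge_int : IntegrableOn ge (Ioi 0) :=
  (FS.ge 0).integrableOn (by norm_num) (Δ := 1 / 8) (by norm_num) le_rfl

lemma tge_int : IntegrableOn (fun t : ℝ => -Complex.I * (t : ℂ) * ge t) (Ioi 0) :=
  ((FS.idm 0 (-Complex.I)).mul (FS.ge 0) (j := 0) rfl rfl (e := 1) rfl).integrableOn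
    (by norm_num) (Δ := 1 / 8) (by norm_num) le_rfl

lemma ker_re (t y : ℝ) (r : ℝ) :
    (Complex.exp (-(Complex.I * (t : ℂ) * (y : ℂ))) * (r : ℂ)).re = Real.cos (t * y) * r := by
  have : -(Complex.I * (t : ℂ) * (y : ℂ)) = ((-(t * y) : ℝ) : ℂ) * Complex.I := by
    push_cast; ring
  rw [this, Complex.re_mul_ofReal, Complex.exp_ofReal_mul_I_re, Real.cos_neg]

lemma ge_ofReal (t : ℝ) : ge t = ((Real.exp (-t ^ 2) : ℝ) : ℂ) := by
  unfold ge; push_cast; rfl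

lemma G_eq (y : ℝ) : (1 / Real.pi) * (Ft ge y).re = normalDensity y := by
  have hre : (Ft ge y).re = ∫ t in Ioi (0 : ℝ), Real.cos (t * y) * Real.exp (-t ^ 2) := by
    have := integral_re (𝕜 := ℂ) (ker_integrableOn ge_int y)
    unfold Ft
    simp only [RCLike.re_eq_complex_re] at this
    rw [← this]
    congr 1; ext t
    rw [ge_ofReal, ker_re]
  have hkint : Integrable (fun t : ℝ => Complex.exp (-(Complex.I * (t : ℂ) * (y : ℂ))) * ge t) := by
    have := integrable_cexp_quadratic (b := 1) (by simp) (-(Complex.I * y)) 0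
    refine this.congr (Eventually.of_forall fun t => ?_)
    simp only [ge]
    rw [← Complex.exp_add]; congr 1; ring
  have hfull : ∫ t : ℝ, Real.cos (t * y) * Real.exp (-t ^ 2)
      = Real.sqrt Real.pi * Real.exp (-(y ^ 2) / 4) := by
    have e1 := integral_re (𝕜 := ℂ) hkint
    simp only [RCLike.re_eq_complex_re] at e1
    have e2 := fourierIntegral_gaussian (b := 1) (by simp) (-(y : ℂ))
    have e3 : (∫ t : ℝ, Complex.exp (-(Complex.I * (t : ℂ) * (y : ℂ))) * ge t)
        = ((Real.sqrt Real.pi * Real.exp (-(y ^ 2) / 4) : ℝ) : ℂ) := by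
      calc _ = ∫ x : ℝ, Complex.exp (Complex.I * -(y : ℂ) * x) * Complex.exp (-1 * (x : ℂ) ^ 2) := by
            congr 1; ext t; unfold ge
            congr 2 <;> ring
        _ = _ := by
            rw [e2, Real.sqrt_eq_rpow]
            push_cast
            rw [Complex.ofReal_cpow Real.pi_pos.le]
            congr 2
            · simp
            · push_cast; norm_num
            · ring
    rw [e3, Complex.ofReal_re] at e1
    rw [← e1]
    congr 1; ext t
    rw [ge_ofReal, ker_re]
  have habs := integral_comp_abs (f := fun t => Real.cos (t * y) * Real.exp (-t ^ 2))
  have : (∫ t : ℝ, (fun t => Real.cos (t * y) * Real.exp (-t ^ 2)) |t|)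
      = ∫ t : ℝ, Real.cos (t * y) * Real.exp (-t ^ 2) := by
    congr 1; ext t
    simp only [sq_abs]
    rcases abs_cases t with ⟨h, _⟩ | ⟨h, _⟩ <;> rw [h]
    rw [neg_mul, Real.cos_neg]
  rw [this, hfull] at habs
  rw [hre]
  unfold normalDensity
  have hs : Real.sqrt Real.pi * Real.sqrt Real.pi = Real.pi := Real.mul_self_sqrt Real.pi_pos.le
  have hs0 : 0 < Real.sqrt Real.pi := Real.sqrt_pos.2 Real.pi_pos
  have h3 : (∫ t in Ioi (0 : ℝ), Real.cos (t * y) * Real.exp (-t ^ 2))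
      = Real.sqrt Real.pi * Real.exp (-(y ^ 2) / 4) / 2 := by linarith
  rw [h3]
  nth_rewrite 1 [← hs]
  field_simp

lemma normalDensity_hasDerivAt (y : ℝ) :
    HasDerivAt normalDensity (-(y / 2) * normalDensity y) y := by
  unfold normalDensity
  have := ((((hasDerivAt_id y).pow 2).neg.div_const 4).exp).const_mul (1 / (2 * Real.sqrt Real.pi))
  refine this.congr_deriv ?_
  simp; ring

lemma G'_eq (y : ℝ) : (1 / Real.pi) * (Ft (fun t : ℝ => -Complex.I * (t : ℂ) * ge t) y).re
    = -(y / 2) * normalDensity y := by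
  have h := re_hasDerivAt (Ft_hasDerivAt ge_int tge_int y) (1 / Real.pi)
  have e : (fun x => 1 / Real.pi * (Ft ge x).re) = normalDensity := by
    ext x; exact G_eq x
  rw [e] at h
  exact h.unique (normalDensity_hasDerivAt y)

noncomputable def mm (p t : ℝ) : ℂ := ((t ^ p : ℝ) : ℂ) * ee t

lemma FS.mm (n : ℕ) (p : ℝ) : FS n 0 (p - 1 / 4) 1 (fun _ => mm p) := by
  refine ((FS.cpow n p 1).mul (FS.ee n) (j := 0) rfl (by ring) (e := 1) rfl).congr ?_
  intro Δ h1 h2 t ht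
  simp [_root_.mm]

lemma mm_int {p : ℝ} (hp : 0 ≤ p) : IntegrableOn (mm p) (Ioi 0) :=
  (FS.mm 0 p).integrableOn (by linarith) (Δ := 1 / 8) (by norm_num) le_rfl

lemma mm_hasDerivAt (p : ℝ) {t : ℝ} (ht : 0 < t) :
    HasDerivAt (mm (p + 1)) (((p + 1 : ℝ) : ℂ) * mm p t - mm (p + 1) t) t := by
  have h1 := (Real.hasDerivAt_rpow_const (p := p + 1) (Or.inl ht.ne')).ofReal_comp
  refine (h1.mul (ee_hasDerivAt t)).congr_deriv ?_
  unfold mm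
  rw [show p + 1 - 1 = p by ring]
  push_cast; ring

lemma mm_tendsto {p : ℝ} (hp : 0 < p) : Tendsto (mm p) (𝓝[>] 0) (𝓝 0) := by
  have h1 : ContinuousAt (mm p) 0 := by
    unfold mm
    refine ContinuousAt.mul ?_ (ee_hasDerivAt 0).continuousAt
    exact Complex.continuous_ofReal.continuousAt.comp
      (Real.continuousAt_rpow_const 0 p (Or.inr hp.le))
  have h2 : mm p 0 = 0 := by simp [mm, Real.zero_rpow hp.ne']
  have := h1.tendsto
  rw [h2] at this
  exact this.mono_left nhdsWithin_le_nhds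

noncomputable def zz (y : ℝ) : ℂ := 1 + Complex.I * (y : ℂ)

lemma zz_re (y : ℝ) : (zz y).re = 1 := by simp [zz]
lemma zz_im (y : ℝ) : (zz y).im = y := by simp [zz]
lemma zz_ne (y : ℝ) : zz y ≠ 0 := by
  intro h; have := zz_re y; rw [h] at this; simp at this

lemma Ft_mm_succ {p : ℝ} (hp : 0 ≤ p) (y : ℝ) :
    Ft (mm (p + 1)) y = ((p + 1 : ℝ) : ℂ) * Ft (mm p) y / zz y := by
  have i1 := mm_int hp
  have i2 := mm_int (p := p + 1) (by linarith)
  have h := Ft_parts (g := mm (p + 1)) (fun t ht => mm_hasDerivAt p ht) i2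
    ((i1.const_mul _).sub i2) (mm_tendsto (by linarith)) y
  rw [Ft_sub (i1.const_mul _) i2, Ft_const_mul] at h
  rw [eq_div_iff (zz_ne y)]
  unfold zz
  linear_combination -h

lemma zz_hasDerivAt (y : ℝ) : HasDerivAt zz Complex.I y := by
  refine (((ofReal_hasDerivAt y).const_mul Complex.I).const_add 1).congr_deriv ?_
  ring

lemma zz_slit (y : ℝ) : zz y ∈ Complex.slitPlane := by
  left; rw [zz_re]; norm_num

noncomputable def ll (y : ℝ) : ℂ := Complex.log (zz y)

lemma ll_hasDerivAt (y : ℝ) : HasDerivAt ll (Complex.I / zz y) y :=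
  (zz_hasDerivAt y).clog_real (zz_slit y)

lemma mm_deriv_int {p : ℝ} (hp : 0 ≤ p) :
    IntegrableOn (fun t : ℝ => -Complex.I * (t : ℂ) * mm p t) (Ioi 0) :=
  ((FS.idm 0 (-Complex.I)).mul (FS.mm 0 p) (j := 0) rfl rfl (e := 1) rfl).integrableOn
    (by linarith) (Δ := 1 / 8) (by norm_num) le_rfl

lemma Ft_mm {p : ℝ} (hp : 0 ≤ p) (y : ℝ) :
    Ft (mm p) y = (Real.Gamma (p + 1) : ℂ) * Complex.exp (-((p + 1 : ℝ) : ℂ) * ll y) := by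
  have hd : ∀ y, HasDerivAt (fun y => Complex.exp (((p + 1 : ℝ) : ℂ) * ll y) * Ft (mm p) y) 0 y := by
    intro y
    have h1 := ((ll_hasDerivAt y).const_mul ((p + 1 : ℝ) : ℂ)).cexp
    have h2 := Ft_hasDerivAt (mm_int hp) (mm_deriv_int hp) y
    refine (h1.mul h2).congr_deriv ?_
    have e : Ft (fun t : ℝ => -Complex.I * (t : ℂ) * mm p t) y
        = -Complex.I * (((p + 1 : ℝ) : ℂ) * Ft (mm p) y / zz y) := by
      rw [← Ft_mm_succ hp, ← Ft_const_mul]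
      refine Ft_congr (fun t ht => ?_) y
      unfold mm
      rw [Real.rpow_add ht, Real.rpow_one]
      push_cast; ring
    rw [e]
    ring
  have hc := is_const_of_deriv_eq_zero (fun y => (hd y).differentiableAt) (fun y => (hd y).deriv)
    y 0
  have h0 : Ft (mm p) 0 = (Real.Gamma (p + 1) : ℂ) := by
    rw [Real.Gamma_eq_integral (by linarith)]
    unfold Ft
    rw [← integral_complex_ofReal]
    refine setIntegral_congr_fun measurableSet_Ioi (fun t ht => ?_)
    simp [mm, ee, mul_comm]
  have hl0 : ll 0 = 0 := by simp [ll, zz]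
  simp only [hl0, mul_zero, Complex.exp_zero, one_mul, h0] at hc
  rw [← hc, neg_mul, Complex.exp_neg]
  field_simp [Complex.exp_ne_zero]

lemma exp_ll_nat (n : ℕ) (y : ℝ) : Complex.exp (-(n : ℂ) * ll y) = ((zz y) ^ n)⁻¹ := by
  rw [neg_mul, Complex.exp_neg, Complex.exp_nat_mul, ll, Complex.exp_log (zz_ne y)]

noncomputable def zD (Δ y : ℝ) : ℂ := Complex.exp ((Δ : ℂ) * ll y)

lemma exp_ll_sub (n : ℕ) (Δ y : ℝ) :
    Complex.exp (-((n : ℂ) - Δ) * ll y) = ((zz y) ^ n)⁻¹ * zD Δ y := by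
  rw [← exp_ll_nat, zD, ← Complex.exp_add]; congr 1; ring

lemma Ft_mm1 (y : ℝ) : Ft (mm 1) y = ((zz y) ^ 2)⁻¹ := by
  rw [Ft_mm (by norm_num), show (1 + 1 : ℝ) = 2 by norm_num, Real.Gamma_two]
  have := exp_ll_nat 2 y
  push_cast at this ⊢
  rw [this, one_mul]

lemma Ft_mm2 (y : ℝ) : Ft (mm 2) y = 2 * ((zz y) ^ 3)⁻¹ := by
  have := Ft_mm_succ (p := 1) (by norm_num) y
  rw [show (1 + 1 : ℝ) = 2 by norm_num, Ft_mm1] at this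
  rw [this]
  have := zz_ne y
  field_simp; push_cast; rfl

lemma Ft_mm3 (y : ℝ) : Ft (mm 3) y = 6 * ((zz y) ^ 4)⁻¹ := by
  have := Ft_mm_succ (p := 2) (by norm_num) y
  rw [show (2 + 1 : ℝ) = 3 by norm_num, Ft_mm2] at this
  rw [this]
  have := zz_ne y
  field_simp; push_cast; norm_num

noncomputable def gam (Δ : ℝ) : ℝ := Real.Gamma (3 - Δ)

lemma Ft_mma {Δ : ℝ} (h2 : Δ ≤ 1 / 8) (y : ℝ) :
    Ft (mm (2 - Δ)) y = gam Δ * (((zz y) ^ 3)⁻¹ * zD Δ y) := by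
  rw [Ft_mm (by linarith), show (2 - Δ + 1 : ℝ) = 3 - Δ by ring, ← exp_ll_sub]
  push_cast; rfl

lemma Ft_mma1 {Δ : ℝ} (h2 : Δ ≤ 1 / 8) (y : ℝ) :
    Ft (mm (2 - Δ + 1)) y = gam Δ * (3 - Δ) * (((zz y) ^ 4)⁻¹ * zD Δ y) := by
  rw [Ft_mm_succ (by linarith), Ft_mma h2]
  have := zz_ne y
  field_simp; push_cast; ring

lemma gam_bounds {Δ : ℝ} (h1 : 0 < Δ) (h2 : Δ ≤ 1 / 8) : 2 - 4 * Δ ≤ gam Δ ∧ gam Δ ≤ 2 := by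
  have h3 : Real.Gamma 3 = 2 := by
    rw [show (3 : ℝ) = 2 + 1 by norm_num, Real.Gamma_add_one (by norm_num), Real.Gamma_two]
    norm_num
  have h4 : Real.Gamma 4 = 6 := by
    rw [show (4 : ℝ) = 3 + 1 by norm_num, Real.Gamma_add_one (by norm_num), h3]
    norm_num
  have h5 := Real.Gamma_two
  have hc : ∀ x y : ℝ, 0 < x → 0 < y → ∀ a b : ℝ, 0 ≤ a → 0 ≤ b → a + b = 1 →
      Real.Gamma (a * x + b * y) ≤ a * Real.Gamma x + b * Real.Gamma y :=
    fun x y hx hy a b ha hb hab => Real.convexOn_Gamma.2 hx hy ha hb hab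
  unfold gam
  constructor
  · have := hc (3 - Δ) 4 (by linarith) (by norm_num)
      (1 / (1 + Δ)) (Δ / (1 + Δ)) (by positivity) (by positivity) (by field_simp)
    rw [show 1 / (1 + Δ) * (3 - Δ) + Δ / (1 + Δ) * 4 = 3 by field_simp; ring, h3, h4] at this
    have h6 : 1 / (1 + Δ) * Real.Gamma (3 - Δ) + Δ / (1 + Δ) * 6
      = (Real.Gamma (3 - Δ) + 6 * Δ) / (1 + Δ) := by field_simp
    rw [h6, le_div_iff₀ (by linarith)] at this
    linarith
  · have := hc 2 3 (by norm_num) (by norm_num) Δ (1 - Δ) (by linarith) (by linarith) (by ring)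
    rw [show Δ * 2 + (1 - Δ) * 3 = 3 - Δ by ring, h3, h5] at this
    linarith

/-- `q = |z|^Δ`. -/
noncomputable def qz (Δ y : ℝ) : ℝ := Real.exp (Δ * Real.log ‖zz y‖)

lemma one_le_norm_zz (y : ℝ) : 1 ≤ ‖zz y‖ := by
  have := Complex.abs_re_le_norm (zz y)
  rw [zz_re, abs_one] at this; exact this

lemma abs_le_norm_zz (y : ℝ) : |y| ≤ ‖zz y‖ := by
  have := Complex.abs_im_le_norm (zz y)
  rwa [zz_im] at this

lemma norm_zz_le (y : ℝ) : ‖zz y‖ ≤ 1 + |y| := by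
  unfold zz
  refine (norm_add_le _ _).trans ?_
  simp

lemma one_le_qz {Δ : ℝ} (h1 : 0 < Δ) (y : ℝ) : 1 ≤ qz Δ y :=
  Real.one_le_exp (mul_nonneg h1.le (Real.log_nonneg (one_le_norm_zz y)))

lemma norm_zD (Δ y : ℝ) : ‖zD Δ y‖ = qz Δ y := by
  unfold zD qz ll
  rw [Complex.norm_exp, Complex.re_ofReal_mul, Complex.log_re]

lemma ll_norm (y : ℝ) : ‖ll y‖ ≤ ‖zz y‖ + 2 := by
  have h := Complex.norm_le_abs_re_add_abs_im (ll y)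
  have h1 : (ll y).re = Real.log ‖zz y‖ := Complex.log_re _
  have h2 : |(ll y).im| ≤ 2 := by
    unfold ll; rw [Complex.log_im]
    have := Complex.abs_arg_le_pi_div_two_iff.2 (show 0 ≤ (zz y).re by rw [zz_re]; norm_num)
    linarith [Real.pi_lt_d2]
  have h3 := one_le_norm_zz y
  have h4 := Real.log_nonneg h3
  have h5 := Real.log_le_sub_one_of_pos (show 0 < ‖zz y‖ by linarith)
  rw [h1, abs_of_nonneg h4] at h
  linarith

lemma qz_neg (Δ y : ℝ) : qz Δ (-y) = qz Δ y := by
  unfold qz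
  have : ‖zz (-y)‖ = ‖zz y‖ := by
    rw [← Complex.norm_conj]
    congr 1
    unfold zz; simp
  rw [this]

noncomputable def hX (β Δ y : ℝ) : ℝ :=
  (1 / Real.pi) * (Ft (fun t : ℝ => -Complex.I * (t : ℂ) * phi β Δ t) y).re

noncomputable def hB (β Δ y : ℝ) : ℝ :=
  (Tt Δ / Real.pi) * (Ft (fun t => qq Δ t * phi β Δ t) y).re

lemma inv_pi_re_le (w : ℂ) : |(1 / Real.pi) * w.re| ≤ ‖w‖ := by
  rw [abs_mul, abs_of_pos (by positivity)]
  have h1 := Complex.abs_re_le_norm w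
  have h2 : 1 / Real.pi ≤ 1 := by
    rw [div_le_one Real.pi_pos]; linarith [Real.pi_gt_three]
  have h3 : 0 < 1 / Real.pi := by positivity
  nlinarith [abs_nonneg w.re]

lemma hD_sub {β Δ : ℝ} (hb : |β| ≤ 1) (h1 : 0 < Δ) (h2 : Δ ≤ 1 / 8) (y : ℝ) :
    hD β Δ y - normalDensity y = (1 / Real.pi) * (Ft (rho β Δ) y).re := by
  have : Ft (rho β Δ) y = Ft (phi β Δ) y - Ft ge y := Ft_sub (phi_int β hb h1 h2) ge_int y
  rw [this, ← G_eq, hD, Complex.sub_re]; ring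

lemma hX_sub {β Δ : ℝ} (hb : |β| ≤ 1) (h1 : 0 < Δ) (h2 : Δ ≤ 1 / 8) (y : ℝ) :
    hX β Δ y + y / 2 * normalDensity y
      = (1 / Real.pi) * (Ft (fun t : ℝ => -Complex.I * (t : ℂ) * rho β Δ t) y).re := by
  have : Ft (fun t : ℝ => -Complex.I * (t : ℂ) * rho β Δ t) y
      = Ft (fun t : ℝ => -Complex.I * (t : ℂ) * phi β Δ t) y
        - Ft (fun t : ℝ => -Complex.I * (t : ℂ) * ge t) y := by
    rw [← Ft_sub (tphi_int β hb h1 h2) tge_int y]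
    refine Ft_congr (fun t ht => ?_) y
    unfold rho; ring
  have h3 := G'_eq y
  rw [this, Complex.sub_re, hX]; linarith

lemma B1 {β : ℝ} (hb : |β| ≤ 1) : ∃ C : ℝ, 0 ≤ C ∧ ∀ Δ, 0 < Δ → Δ ≤ 1 / 8 → ∀ y : ℝ,
    |hD β Δ y - normalDensity y| ≤ C * Δ ∧ y ^ 2 * |hD β Δ y - normalDensity y| ≤ C * Δ := by
  obtain ⟨C0, hC0, H0⟩ := (FS.rho 0 hb).ft (by norm_num)
  obtain ⟨C2, hC2, H2⟩ := (FS.rho 2 hb).ft (by norm_num)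
  refine ⟨C0 + C2, by positivity, fun Δ h1 h2 y => ?_⟩
  have a0 := H0 Δ h1 h2 y
  have a2 := H2 Δ h1 h2 y
  rw [hD_sub hb h1 h2]
  have a3 := inv_pi_re_le (Ft (rho β Δ) y)
  simp only [pow_zero, one_mul, pow_one, sq_abs] at a0 a2
  refine ⟨by nlinarith, ?_⟩
  calc _ ≤ y ^ 2 * ‖Ft (rho β Δ) y‖ := by gcongr
    _ ≤ _ := by nlinarith

lemma B2 {β : ℝ} (hb : |β| ≤ 1) : ∃ C : ℝ, 0 ≤ C ∧ ∀ Δ, 0 < Δ → Δ ≤ 1 / 8 → ∀ y : ℝ,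
    |hX β Δ y + y / 2 * normalDensity y| ≤ C * Δ ∧
    |y| ^ 3 * |hX β Δ y + y / 2 * normalDensity y| ≤ C * Δ := by
  obtain ⟨C0, hC0, H0⟩ := (FS.trho 0 hb).ft (by norm_num)
  obtain ⟨C2, hC2, H2⟩ := (FS.trho 3 hb).ft (by norm_num)
  refine ⟨C0 + C2, by positivity, fun Δ h1 h2 y => ?_⟩
  have a0 := H0 Δ h1 h2 y
  have a2 := H2 Δ h1 h2 y
  rw [hX_sub hb h1 h2]
  have a3 := inv_pi_re_le (Ft (fun t : ℝ => -Complex.I * (t : ℂ) * rho β Δ t) y)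
  simp only [pow_zero, one_mul, pow_one] at a0 a2
  refine ⟨by nlinarith, ?_⟩
  calc _ ≤ |y| ^ 3 * ‖Ft (fun t : ℝ => -Complex.I * (t : ℂ) * rho β Δ t) y‖ := by gcongr
    _ ≤ _ := by nlinarith

lemma hB_le {β Δ : ℝ} (h1 : 0 < Δ) (h2 : Δ ≤ 1 / 8) (y : ℝ) :
    |hB β Δ y| ≤ 2 * Δ * |(Ft (fun t => qq Δ t * phi β Δ t) y).re| := by
  obtain ⟨t1, t2⟩ := Tt_bounds h1 h2
  unfold hB
  rw [abs_mul, abs_of_nonneg (div_nonneg (by linarith) Real.pi_pos.le)]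
  gcongr
  rw [div_le_iff₀ Real.pi_pos]
  nlinarith [Real.pi_gt_three]

lemma B3a {β : ℝ} (hb : |β| ≤ 1) : ∃ C : ℝ, 0 ≤ C ∧ ∀ Δ, 0 < Δ → Δ ≤ 1 / 8 → ∀ y : ℝ,
    |hB β Δ y| ≤ C * Δ := by
  obtain ⟨C0, hC0, H0⟩ := (FS.qphi 0 hb).ft (by norm_num)
  refine ⟨2 * C0, by positivity, fun Δ h1 h2 y => ?_⟩
  have a0 := H0 Δ h1 h2 y
  simp only [pow_zero, one_mul, mul_one] at a0
  have a1 := hB_le (β := β) h1 h2 y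
  have a2 := Complex.abs_re_le_norm (Ft (fun t => qq Δ t * phi β Δ t) y)
  calc _ ≤ 2 * Δ * C0 := a1.trans (by gcongr; linarith)
    _ = _ := by ring

lemma Ft_qc {Δ : ℝ} (h2 : Δ ≤ 1 / 8) (y : ℝ) : Ft (fun t => qq Δ t * cc t) y
    = Complex.I * (((zz y) ^ 2)⁻¹ + 2 * ((zz y) ^ 3)⁻¹ - gam Δ * (((zz y) ^ 3)⁻¹ * zD Δ y)
      - gam Δ * (3 - Δ) * (((zz y) ^ 4)⁻¹ * zD Δ y)) := by
  have i1 := mm_int (p := 1) (by norm_num)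
  have i2 := mm_int (p := 2) (by norm_num)
  have i3 := mm_int (p := 2 - Δ) (by linarith)
  have i4 := mm_int (p := 2 - Δ + 1) (by linarith)
  have i12 : IntegrableOn (fun t => mm 1 t + mm 2 t) (Ioi 0) := i1.add i2
  have i123 : IntegrableOn (fun t => mm 1 t + mm 2 t - mm (2 - Δ) t) (Ioi 0) := i12.sub i3
  rw [← Ft_mm1, ← Ft_mm2, ← Ft_mma h2, ← Ft_mma1 h2, ← Ft_add i1 i2, ← Ft_sub i12 i3,
    ← Ft_sub i123 i4, ← Ft_const_mul]
  refine Ft_congr (fun t ht => ?_) y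
  unfold qq cc mm ee
  rw [Real.rpow_add ht, Real.rpow_one, Real.rpow_two]
  push_cast; ring

lemma norm_inv_zz_pow {y : ℝ} (hy : 0 < |y|) (n : ℕ) :
    ‖((zz y) ^ n)⁻¹‖ ≤ (|y| ^ n)⁻¹ := by
  rw [norm_inv, norm_pow]
  have := abs_le_norm_zz y
  gcongr

lemma re_I_zz (y : ℝ) (hy : 0 < |y|) : |(Complex.I * ((zz y) ^ 2)⁻¹).re| ≤ 2 * (|y| ^ 3)⁻¹ := by
  have e : (Complex.I * ((zz y) ^ 2)⁻¹).re = 2 * y / (1 + y ^ 2) ^ 2 := by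
    have h1 : (1 + y ^ 2 : ℝ) ≠ 0 := by positivity
    have h2 : ((zz y) ^ 2)⁻¹ = ((1 - Complex.I * y) / ((1 + y ^ 2 : ℝ) : ℂ)) ^ 2 := by
      rw [← inv_pow]
      congr 1
      rw [inv_eq_iff_eq_inv, inv_div, eq_div_iff]
      · unfold zz; push_cast; linear_combination (-(y : ℂ) ^ 2) * Complex.I_sq
      · intro h
        have := congrArg Complex.re h
        simp at this
    rw [h2, div_pow, ← Complex.ofReal_pow, mul_div_assoc', Complex.div_ofReal_re]
    congr 1
    simp [sq]; ring
  rw [e, abs_div, abs_mul, abs_of_pos (show (0 : ℝ) < 2 by norm_num),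
    abs_of_pos (show 0 < (1 + y ^ 2) ^ 2 by positivity), ← div_eq_mul_inv,
    div_le_div_iff₀ (by positivity) (by positivity)]
  rw [← sq_abs y]
  nlinarith [sq_nonneg (|y|)]

lemma B3b {β : ℝ} (hb : |β| ≤ 1) : ∃ C : ℝ, 0 ≤ C ∧ ∀ Δ, 0 < Δ → Δ ≤ 1 / 8 → ∀ y : ℝ,
    1 ≤ |y| → |hB β Δ y| ≤ C * Δ * (qz Δ y * (|y| ^ 3)⁻¹) := by
  obtain ⟨C0, hC0, H0⟩ := (FS.r2 3 hb).ft (by norm_num)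
  refine ⟨2 * (C0 + 12), by positivity, fun Δ h1 h2 y hy => ?_⟩
  have hy0 : 0 < |y| := by linarith
  have a0 := H0 Δ h1 h2 y
  have a1 := hB_le (β := β) h1 h2 y
  have hq := one_le_qz h1 y
  obtain ⟨g1, g2⟩ := gam_bounds h1 h2
  have e : Ft (fun t => qq Δ t * phi β Δ t) y = Ft (fun t => qq Δ t * (phi β Δ t - cc t)) y
      + Ft (fun t => qq Δ t * cc t) y := by
    have j1 := (FS.r2 0 hb).integrableOn (by norm_num) h1 h2
    have j2 := qphi_int β hb h1 h2
    have j3 : IntegrableOn (fun t => qq Δ t * cc t) (Ioi 0) := by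
      refine (j2.sub j1).congr (Eventually.of_forall fun t => ?_)
      simp only [Pi.sub_apply]; ring
    rw [← Ft_add j1 j3]
    refine Ft_congr (fun t ht => ?_) y
    ring
  set P := (|y| ^ 3)⁻¹ with hP
  have hP0 : 0 < P := by positivity
  have b1 : ‖Ft (fun t => qq Δ t * (phi β Δ t - cc t)) y‖ ≤ C0 * P := by
    rw [hP, ← div_eq_mul_inv, le_div_iff₀ (by positivity)]
    simp only [pow_zero, mul_one] at a0
    linarith
  have n3 := norm_inv_zz_pow hy0 3
  have n4 := norm_inv_zz_pow hy0 4
  have n4' : ‖((zz y) ^ 4)⁻¹‖ ≤ P := by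
    refine n4.trans ?_
    rw [hP]
    gcongr
    norm_num
  have b2 := re_I_zz y hy0
  have b3 : |(Ft (fun t => qq Δ t * cc t) y).re| ≤ 12 * (qz Δ y * P) := by
    rw [Ft_qc h2]
    set A : ℂ := 2 * ((zz y) ^ 3)⁻¹ - gam Δ * (((zz y) ^ 3)⁻¹ * zD Δ y)
      - gam Δ * (3 - Δ) * (((zz y) ^ 4)⁻¹ * zD Δ y) with hA
    have e2 : Complex.I * (((zz y) ^ 2)⁻¹ + 2 * ((zz y) ^ 3)⁻¹ - gam Δ * (((zz y) ^ 3)⁻¹ * zD Δ y)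
      - gam Δ * (3 - Δ) * (((zz y) ^ 4)⁻¹ * zD Δ y)) = Complex.I * ((zz y) ^ 2)⁻¹
        + Complex.I * A := by rw [hA]; ring
    rw [e2, Complex.add_re]
    have hAn : ‖A‖ ≤ 2 * P + 2 * (P * qz Δ y) + 2 * 3 * (P * qz Δ y) := by
      have gn : ‖(gam Δ : ℂ)‖ ≤ 2 := by
        rw [Complex.norm_real, Real.norm_of_nonneg (by linarith)]; exact g2
      have dn : ‖(3 : ℂ) - Δ‖ ≤ 3 := by
        have : (3 : ℂ) - Δ = ((3 - Δ : ℝ) : ℂ) := by push_cast; rfl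
        rw [this, Complex.norm_real, Real.norm_of_nonneg (by linarith)]; linarith
      have hq0 : 0 ≤ qz Δ y := by linarith
      rw [hA]
      refine (norm_sub_le _ _).trans (add_le_add ((norm_sub_le _ _).trans (add_le_add ?_ ?_)) ?_)
      · rw [norm_mul]; simp only [Complex.norm_ofNat]; gcongr
      · rw [norm_mul, norm_mul, norm_zD]; gcongr
      · rw [norm_mul, norm_mul, norm_mul, norm_zD]; gcongr
    have hA2 : |(Complex.I * A).re| ≤ ‖A‖ := by
      refine (Complex.abs_re_le_norm _).trans ?_
      rw [norm_mul, Complex.norm_I, one_mul]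
    refine (abs_add_le _ _).trans ?_
    nlinarith [mul_le_mul_of_nonneg_right hq hP0.le]
  have b4 : |(Ft (fun t => qq Δ t * phi β Δ t) y).re| ≤ (C0 + 12) * (qz Δ y * P) := by
    rw [e, Complex.add_re]
    refine (abs_add_le _ _).trans ?_
    have := Complex.abs_re_le_norm (Ft (fun t => qq Δ t * (phi β Δ t - cc t)) y)
    have h7 : C0 * P ≤ C0 * (qz Δ y * P) := by
      gcongr; nlinarith
    linarith
  calc _ ≤ 2 * Δ * ((C0 + 12) * (qz Δ y * P)) := a1.trans (by gcongr)
    _ = _ := by ring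

/-- approximate antisymmetry -/
lemma B4 {β : ℝ} (hb : |β| ≤ 1) : ∃ C : ℝ, 0 ≤ C ∧ ∀ Δ, 0 < Δ → Δ ≤ 1 / 8 → ∀ x : ℝ,
    |fBeta (2 - Δ) β x + fBeta (2 - Δ) β (-x)| ≤ C * Δ ^ 2 := by
  have hF : FS 0 0 (3 / 2) 1 (fun Δ t => qq Δ t * (qq Δ t * phi 0 Δ t)) :=
    (FS.qq 0).mul (FS.qphi 0 (by simp)) rfl (by norm_num) rfl
  obtain ⟨C, k, hC, H⟩ := hF
  have hw := wt_integrable k (p := 3 / 2) (by norm_num)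
  have hI : 0 ≤ ∫ t in Ioi (0 : ℝ), wt (3 / 2) k 1 t :=
    setIntegral_nonneg measurableSet_Ioi fun t ht => wt_nonneg _ _ _ ht
  refine ⟨2 * (4 * (C * ∫ t in Ioi (0 : ℝ), wt (3 / 2) k 1 t)), by positivity,
    fun Δ h1 h2 x => ?_⟩
  obtain ⟨t1, t2⟩ := Tt_bounds h1 h2
  have hT0 : 0 ≤ Tt Δ := by linarith
  rw [fBeta_eq' β h1 h2, fBeta_eq' β h1 h2, ← mul_add, ← Complex.add_re]
  have i1 := ker_integrableOn (qpsi_int β h1 h2) x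
  have i2 := ker_integrableOn (qpsi_int β h1 h2) (-x)
  have key : |(Ft (fun t => qq Δ t * (phi 0 Δ t * Complex.exp ((β : ℂ) * (Tt Δ * qq Δ t)))) x
      + Ft (fun t => qq Δ t * (phi 0 Δ t * Complex.exp ((β : ℂ) * (Tt Δ * qq Δ t)))) (-x)).re|
      ≤ ∫ t in Ioi (0 : ℝ), 4 * Δ * (C * wt (3 / 2) k 1 t) := by
    unfold Ft
    rw [← integral_add i1 i2]
    have hre := integral_re (𝕜 := ℂ) (i1.add i2)
    simp only [RCLike.re_eq_complex_re, Pi.add_apply] at hre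
    rw [← hre, ← Real.norm_eq_abs]
    refine norm_integral_le_of_norm_le ((hw.const_mul C).const_mul (4 * Δ)) ?_
    filter_upwards [ae_restrict_mem measurableSet_Ioi] with t ht
    have hbd := (H Δ h1 h2).bound t ht
    simp only [pow_zero, mul_one] at hbd
    set s := t - t ^ (2 - Δ) with hs
    set E := Real.exp (-(t ^ (2 - Δ))) with hE
    have hE0 : 0 < E := Real.exp_pos _
    have p0 : phi 0 Δ t = (E : ℂ) := by
      unfold phi kap; rw [hE]; push_cast; simp
    have q0 : qq Δ t = Complex.I * (s : ℂ) := rfl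
    have ex : Complex.exp ((β : ℂ) * (Tt Δ * qq Δ t))
        = Complex.exp (((β * Tt Δ * s : ℝ) : ℂ) * Complex.I) := by
      rw [q0]; congr 1; push_cast; ring
    have kx : ∀ x : ℝ, Complex.exp (-(Complex.I * (t : ℂ) * (x : ℂ)))
        = Complex.exp (((-(t * x) : ℝ) : ℂ) * Complex.I) := by
      intro x; congr 1; push_cast; ring
    have val : (Complex.exp (-(Complex.I * (t : ℂ) * (x : ℂ))) *
        (qq Δ t * (phi 0 Δ t * Complex.exp ((β : ℂ) * (Tt Δ * qq Δ t))))
        + Complex.exp (-(Complex.I * (t : ℂ) * ((-x : ℝ) : ℂ))) *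
        (qq Δ t * (phi 0 Δ t * Complex.exp ((β : ℂ) * (Tt Δ * qq Δ t))))).re
        = -(2 * Real.cos (t * x) * (E * (s * Real.sin (β * Tt Δ * s)))) := by
      rw [kx, kx, ex, p0, q0]
      simp only [Complex.add_re, Complex.mul_re, Complex.mul_im, Complex.exp_ofReal_mul_I_re,
        Complex.exp_ofReal_mul_I_im, Complex.ofReal_re, Complex.ofReal_im, Complex.I_re,
        Complex.I_im, Real.cos_neg, Real.sin_neg, mul_neg]
      ring
    rw [val]
    have hbd2 : s ^ 2 * E ≤ C * wt (3 / 2) k 1 t := by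
      rw [q0, p0] at hbd
      simp only [norm_mul, Complex.norm_I, Complex.norm_real, one_mul, Real.norm_eq_abs,
        abs_of_pos hE0] at hbd
      rw [← sq_abs s]; linarith
    rw [Real.norm_eq_abs, abs_neg, abs_mul, abs_mul, abs_mul, abs_mul, abs_of_pos hE0,
      abs_of_pos (show (0 : ℝ) < 2 by norm_num)]
    have c1 := Real.abs_cos_le_one (t * x)
    have c2 : |Real.sin (β * Tt Δ * s)| ≤ 2 * Δ * |s| := by
      refine (Real.abs_sin_le_abs).trans ?_
      rw [abs_mul, abs_mul, abs_of_nonneg hT0]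
      have h9 : |β| * Tt Δ ≤ 2 * Δ := by nlinarith [abs_nonneg β]
      exact mul_le_mul_of_nonneg_right h9 (abs_nonneg s)
    calc _ ≤ 2 * 1 * (E * (|s| * (2 * Δ * |s|))) := by gcongr
      _ = 4 * Δ * (|s| ^ 2 * E) := by ring
      _ ≤ _ := by rw [sq_abs]; gcongr
  rw [integral_const_mul, integral_const_mul] at key
  rw [abs_mul, abs_of_nonneg (div_nonneg hT0 Real.pi_pos.le)]
  have hTp : Tt Δ / Real.pi ≤ 2 * Δ := by
    rw [div_le_iff₀ Real.pi_pos]; nlinarith [Real.pi_gt_three]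
  calc _ ≤ 2 * Δ * (4 * Δ * (C * ∫ t in Ioi (0 : ℝ), wt (3 / 2) k 1 t)) := by gcongr
    _ = _ := by ring

lemma Ft_wc {β Δ : ℝ} (h2 : Δ ≤ 1 / 8) (y : ℝ) : Ft (fun t => ww β Δ t * cc t) y
    = 2 * ((((zz y) ^ 3)⁻¹ + 3 * ((zz y) ^ 4)⁻¹) * (1 - kap β Δ * ((gam Δ : ℂ) / 2 * zD Δ y))
      + kap β Δ * ((gam Δ : ℂ) / 2 * zD Δ y) * Δ * ((zz y) ^ 4)⁻¹) := by
  have i2 := mm_int (p := 2) (by norm_num)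
  have i3 := mm_int (p := 3) (by norm_num)
  have i4 := mm_int (p := 2 - Δ) (by linarith)
  have i5 := mm_int (p := 2 - Δ + 1) (by linarith)
  have i23 : IntegrableOn (fun t => mm 2 t + mm 3 t) (Ioi 0) := i2.add i3
  have i45 : IntegrableOn (fun t => mm (2 - Δ) t + mm (2 - Δ + 1) t) (Ioi 0) := i4.add i5
  have i45' : IntegrableOn (fun t => kap β Δ * (mm (2 - Δ) t + mm (2 - Δ + 1) t)) (Ioi 0) :=
    i45.const_mul _
  have e : Ft (fun t => ww β Δ t * cc t) y = Ft (mm 2) y + Ft (mm 3) y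
      - kap β Δ * (Ft (mm (2 - Δ)) y + Ft (mm (2 - Δ + 1)) y) := by
    rw [← Ft_add i2 i3, ← Ft_add i4 i5, ← Ft_const_mul, ← Ft_sub i23 i45']
    refine Ft_congr (fun t ht => ?_) y
    unfold ww cc mm ee
    have h3 : t ^ (3 : ℝ) = t ^ 3 := by exact_mod_cast Real.rpow_natCast t 3
    rw [Real.rpow_add ht, Real.rpow_one, Real.rpow_two, h3]
    push_cast; ring
  rw [e, Ft_mm2, Ft_mm3, Ft_mma h2, Ft_mma1 h2]
  ring

lemma theta_bounds {y : ℝ} (hy : 1 ≤ y) :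
    Real.pi / 2 - 1 / y ≤ (ll y).im ∧ (ll y).im ≤ Real.pi / 2 ∧ 0 < (ll y).im := by
  have e : (ll y).im = Complex.arg (zz y) := Complex.log_im _
  rw [e]
  have a1 := Complex.abs_arg_lt_pi_div_two_iff.2 (Or.inl (show 0 < (zz y).re by rw [zz_re]; norm_num))
  have a2 : 0 ≤ (zz y).arg := Complex.arg_nonneg_iff.2 (by rw [zz_im]; linarith)
  have a3 := Complex.tan_arg (zz y)
  rw [zz_re, zz_im, div_one] at a3
  have a4 := (abs_lt.1 a1).2
  set θ := (zz y).arg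
  have a5 : 0 < θ := by
    rcases a2.eq_or_lt with h | h
    · rw [← h, Real.tan_zero] at a3; linarith
    · exact h
  refine ⟨?_, a4.le, a5⟩
  have h6 := Real.tan_pi_div_two_sub θ
  rw [a3] at h6
  have h7 := Real.le_tan (x := Real.pi / 2 - θ) (by linarith) (by linarith)
  rw [h6] at h7
  rw [one_div]; linarith

lemma Tt_upper {Δ : ℝ} (h1 : 0 < Δ) (h2 : Δ ≤ 1 / 8) : Tt Δ ≤ Real.pi / 2 * Δ + Δ ^ 2 := by
  have hpi := Real.pi_gt_three
  have hpi2 := Real.pi_lt_d2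
  unfold Tt
  set x := Real.pi * Δ / 2 with hx
  have hx0 : 0 < x := by positivity
  have hx1 : x ≤ 1.58 * Δ := by rw [hx]; nlinarith
  have hx2 : x ≤ 1 / 5 := by linarith
  have hc := Real.one_sub_sq_div_two_le_cos (x := x)
  have hs := Real.sin_lt hx0
  have hc0 : 0 < Real.cos x := by nlinarith
  have h3 : Real.tan x ≤ x * (1 + x ^ 2) := by
    rw [Real.tan_eq_sin_div_cos, div_le_iff₀ hc0]
    have : x ≤ x * (1 + x ^ 2) * (1 - x ^ 2 / 2) := by
      have : 1 ≤ (1 + x ^ 2) * (1 - x ^ 2 / 2) := by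
        have hxx : x ^ 2 ≤ 1 := by nlinarith
        nlinarith [mul_nonneg (sq_nonneg x) (show 0 ≤ 1 - x ^ 2 by linarith)]
      nlinarith
    have h5 : x * (1 + x ^ 2) * (1 - x ^ 2 / 2) ≤ x * (1 + x ^ 2) * Real.cos x := by gcongr
    linarith
  have h4 : x ^ 3 ≤ Δ ^ 2 := by
    calc x ^ 3 ≤ (1.58 * Δ) ^ 3 := by gcongr
      _ ≤ _ := by nlinarith [sq_nonneg Δ, mul_nonneg (sq_nonneg Δ) (show 0 ≤ 1/8 - Δ by linarith)]
  have h5 : x = Real.pi / 2 * Δ := by rw [hx]; ring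
  nlinarith

lemma im_kw {β Δ y : ℝ} (hb : |β| ≤ 1) (h1 : 0 < Δ) (h2 : Δ ≤ 1 / 8) (hy : 1 ≤ y)
    (hd1 : 1 / y ≤ (1 - |β|) / 4) (hd2 : Δ ≤ (1 - |β|) / 8) :
    3 / 4 * (qz Δ y * (Δ * (1 - |β|))) ≤ (kap β Δ * ((gam Δ : ℂ) / 2 * zD Δ y)).im := by
  obtain ⟨t1, t2, t3⟩ := theta_bounds hy
  obtain ⟨g1, g2⟩ := gam_bounds h1 h2
  obtain ⟨T1, T2⟩ := Tt_bounds h1 h2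
  have T3 := Tt_upper h1 h2
  have hpi := Real.pi_gt_three
  have hpi2 := Real.pi_lt_d2
  have hq := one_le_qz h1 y
  set θ := (ll y).im with hθ
  have e : (kap β Δ * ((gam Δ : ℂ) / 2 * zD Δ y)).im
      = gam Δ / 2 * (qz Δ y * (Real.sin (Δ * θ) + β * Tt Δ * Real.cos (Δ * θ))) := by
    have ez : zD Δ y = ((qz Δ y : ℝ) : ℂ) * (Real.cos (Δ * θ) + Real.sin (Δ * θ) * Complex.I) := by
      unfold zD qz
      have : ll y = ((Real.log ‖zz y‖ : ℝ) : ℂ) + (θ : ℂ) * Complex.I := by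
        rw [← Complex.re_add_im (ll y), hθ]; congr 2; exact Complex.log_re _
      rw [this, mul_add, Complex.exp_add]
      push_cast
      rw [← Complex.exp_mul_I]; congr 2; ring
    rw [ez]
    have : kap β Δ * ((gam Δ : ℂ) / 2 *
        (((qz Δ y : ℝ) : ℂ) * (Real.cos (Δ * θ) + Real.sin (Δ * θ) * Complex.I)))
      = ((gam Δ / 2 * (qz Δ y * (Real.cos (Δ * θ) - β * Tt Δ * Real.sin (Δ * θ))) : ℝ) : ℂ)
        + ((gam Δ / 2 * (qz Δ y * (Real.sin (Δ * θ) + β * Tt Δ * Real.cos (Δ * θ))) : ℝ) : ℂ)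
          * Complex.I := by
      unfold kap
      push_cast
      linear_combination ((gam Δ : ℂ) / 2 * ((qz Δ y : ℝ) : ℂ) * β * Tt Δ * Complex.sin (Δ * θ)) *
        Complex.I_sq
    rw [this, Complex.add_im, Complex.ofReal_im, Complex.im_ofReal_mul, Complex.I_im]
    ring
  rw [e]
  have s0 : 0 < Δ * θ := by positivity
  have s1 := Real.sin_gt_sub_cube s0
  have s2 : (Δ * θ) ^ 3 / 6 ≤ Δ ^ 2 := by
    have : Δ * θ ≤ 1.58 * Δ := by nlinarith
    have : (Δ * θ) ^ 3 ≤ (1.58 * Δ) ^ 3 := by gcongr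
    nlinarith [sq_nonneg Δ, mul_nonneg (sq_nonneg Δ) (show 0 ≤ 1/8 - Δ by linarith)]
  have s3 : -(|β| * Tt Δ) ≤ β * Tt Δ * Real.cos (Δ * θ) := by
    have := neg_abs_le (β * Tt Δ * Real.cos (Δ * θ))
    rw [abs_mul, abs_mul, abs_of_nonneg (show 0 ≤ Tt Δ by linarith)] at this
    have h9 := Real.abs_cos_le_one (Δ * θ)
    have h10 : 0 ≤ |β| * Tt Δ := by have := abs_nonneg β; nlinarith
    nlinarith
  have s4 : |β| * Tt Δ ≤ |β| * (Real.pi / 2 * Δ) + Δ ^ 2 := by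
    nlinarith [abs_nonneg β, sq_nonneg Δ]
  have s5 : Δ * (Real.pi / 2) - Δ * (1 / y) ≤ Δ * θ := by nlinarith
  have s6 : Δ * (1 / y) ≤ Δ * ((1 - |β|) / 4) := by gcongr
  have s7 : Δ ^ 2 ≤ Δ * ((1 - |β|) / 8) := by rw [sq]; gcongr
  have s8 : Δ * (1 - |β|) ≤ Real.sin (Δ * θ) + β * Tt Δ * Real.cos (Δ * θ) := by
    have : 1.5 * (Δ * (1 - |β|)) ≤ Real.pi / 2 * (Δ * (1 - |β|)) := by
      have : 0 ≤ Δ * (1 - |β|) := mul_nonneg h1.le (by linarith)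
      nlinarith
    nlinarith
  have s9 : 0 ≤ Δ * (1 - |β|) := mul_nonneg h1.le (by linarith)
  have : 3 / 4 ≤ gam Δ / 2 := by linarith
  gcongr

lemma one_sub_kw {β Δ y : ℝ} (hb : |β| ≤ 1) (h1 : 0 < Δ) (h2 : Δ ≤ 1 / 8) (hy : 1 ≤ y) :
    ‖1 - kap β Δ * ((gam Δ : ℂ) / 2 * zD Δ y)‖ ≤ 14 * (Δ * qz Δ y * y) := by
  obtain ⟨g1, g2⟩ := gam_bounds h1 h2
  have hq := one_le_qz h1 y
  have k1 := kap_sub hb h1 h2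
  have k2 := kap_norm hb h1 h2
  have hl := ll_norm y
  have hz := norm_zz_le y
  rw [abs_of_nonneg (by linarith : (0:ℝ) ≤ y)] at hz
  have hzD : ‖zD Δ y - 1‖ ≤ Δ * (y + 3) * qz Δ y := by
    refine (norm_exp_sub_one_le_max _).trans ?_
    have e : Real.exp (((Δ : ℂ) * ll y).re) = qz Δ y := by
      rw [← Complex.norm_exp]; exact norm_zD Δ y
    rw [e, max_eq_right hq, norm_mul, Complex.norm_real, Real.norm_of_nonneg h1.le]
    gcongr
    linarith
  have hg : ‖(1 : ℂ) - (gam Δ : ℂ) / 2‖ ≤ 2 * Δ := by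
    have : (1 : ℂ) - (gam Δ : ℂ) / 2 = ((1 - gam Δ / 2 : ℝ) : ℂ) := by push_cast; rfl
    rw [this, Complex.norm_real, Real.norm_of_nonneg (by linarith)]; linarith
  have hg2 : ‖(gam Δ : ℂ) / 2‖ ≤ 1 := by
    have : (gam Δ : ℂ) / 2 = ((gam Δ / 2 : ℝ) : ℂ) := by push_cast; rfl
    rw [this, Complex.norm_real, Real.norm_of_nonneg (by linarith)]; linarith
  have e : 1 - kap β Δ * ((gam Δ : ℂ) / 2 * zD Δ y) = (1 - kap β Δ)
      + kap β Δ * ((1 - (gam Δ : ℂ) / 2) - (gam Δ : ℂ) / 2 * (zD Δ y - 1)) := by ring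
  rw [e]
  have : ‖(1 - kap β Δ)
      + kap β Δ * ((1 - (gam Δ : ℂ) / 2) - (gam Δ : ℂ) / 2 * (zD Δ y - 1))‖
      ≤ 2 * Δ + 2 * (2 * Δ + 1 * (Δ * (y + 3) * qz Δ y)) := by
    refine (norm_add_le _ _).trans (add_le_add k1 ?_)
    rw [norm_mul]
    refine mul_le_mul k2 ((norm_sub_le _ _).trans (add_le_add hg ?_)) (norm_nonneg _) (by norm_num)
    rw [norm_mul]
    exact mul_le_mul hg2 hzD (norm_nonneg _) (by norm_num)
  refine this.trans ?_
  have f1 : Δ ≤ Δ * qz Δ y := by nlinarith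
  have f2 : Δ * qz Δ y ≤ Δ * qz Δ y * y := by nlinarith
  nlinarith

lemma main_rat {y : ℝ} (hy : 1 ≤ y) :
    ‖((zz y) ^ 3)⁻¹ + 3 * ((zz y) ^ 4)⁻¹ - Complex.I * (((y ^ 3)⁻¹ : ℝ) : ℂ)‖
      ≤ 17 * (y ^ 5)⁻¹ := by
  have hy0 : (y : ℂ) ≠ 0 := by
    intro h; have := Complex.ofReal_eq_zero.1 h; linarith
  have hz := zz_ne y
  have h1 := one_le_norm_zz y
  have h3 := abs_le_norm_zz y
  rw [abs_of_nonneg (by linarith : (0:ℝ) ≤ y)] at h3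
  have ey : (y : ℂ) = -Complex.I * (zz y - 1) := by
    unfold zz; linear_combination ((y : ℂ)) * Complex.I_sq
  have e : ((zz y) ^ 3)⁻¹ + 3 * ((zz y) ^ 4)⁻¹ - Complex.I * (((y ^ 3)⁻¹ : ℝ) : ℂ)
      = (-6 * (zz y) ^ 2 + 8 * zz y - 3) * Complex.I / ((zz y) ^ 4 * (y : ℂ) ^ 3) := by
    push_cast
    have ey3 : (y : ℂ) ^ 3 = Complex.I * (zz y - 1) ^ 3 := by
      rw [ey]; linear_combination (-Complex.I * (zz y - 1) ^ 3) * Complex.I_sq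
    field_simp
    rw [ey3]; ring
  rw [e, norm_div, norm_mul, norm_mul, norm_pow, norm_pow, Complex.norm_I, Complex.norm_real,
    Real.norm_of_nonneg (by linarith : (0:ℝ) ≤ y), mul_one]
  have hn : ‖-6 * (zz y) ^ 2 + 8 * zz y - 3‖ ≤ 17 * ‖zz y‖ ^ 2 := by
    refine (norm_sub_le _ _).trans ?_
    have := norm_add_le (-6 * (zz y) ^ 2) (8 * zz y)
    rw [norm_mul, norm_mul, norm_pow, norm_neg] at this
    simp only [Complex.norm_ofNat] at this ⊢
    nlinarith
  set r := ‖zz y‖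
  have hr : 0 < r := by linarith
  have hyp : 0 < y := by linarith
  calc _ ≤ 17 * r ^ 2 / (r ^ 4 * y ^ 3) := by gcongr
    _ = 17 / (r ^ 2 * y ^ 3) := by field_simp
    _ ≤ 17 / (y ^ 2 * y ^ 3) := by gcongr
    _ = _ := by rw [div_eq_mul_inv]; ring_nf

lemma key_arith {δ CS CW Δ q P i : ℝ} (hCS : 0 ≤ CS) (hCW : 0 ≤ CW) (h1 : 0 < Δ)
    (hq : 1 ≤ q) (hP0 : 0 < P) (hi : 0 < i) (hd3 : Δ * (4 * (CS + 1)) ≤ δ)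
    (hyi : (481 + CW) * i ≤ δ / 4) :
    CS * Δ ^ 2 * P + (CW * Δ * (P * i) + 480 * (Δ * q * (P * i))) ≤ 1 / 2 * (δ * (Δ * q * P)) := by
  have h0 : Δ * P ≤ Δ * q * P := by nlinarith only [mul_pos h1 hP0, hq]
  have hE : 0 < Δ * q * P := by positivity
  set E := Δ * q * P with hEd
  have u1 : CS * Δ ^ 2 * P ≤ δ / 4 * E := by
    calc CS * Δ ^ 2 * P = CS * Δ * (Δ * P) := by ring
      _ ≤ CS * Δ * E := by gcongr
      _ ≤ δ / 4 * E := by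
        have : CS * Δ ≤ δ / 4 := by nlinarith only [hd3, h1]
        gcongr
  have u2 : CW * Δ * (P * i) ≤ CW * i * E := by
    calc CW * Δ * (P * i) = CW * i * (Δ * P) := by ring
      _ ≤ _ := by gcongr
  have u3 : 480 * (Δ * q * (P * i)) = 480 * i * E := by rw [hEd]; ring
  have u4 : (481 + CW) * i * E ≤ δ / 4 * E := by gcongr
  nlinarith only [u1, u2, u3, u4, mul_pos hi hE]

set_option maxHeartbeats 1000000 in
lemma lower_pos {β : ℝ} (hb : |β| < 1) : ∃ Y : ℝ, 1 ≤ Y ∧ ∃ D : ℝ, 0 < D ∧ D ≤ 1 / 8 ∧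
    ∀ Δ, 0 < Δ → Δ ≤ D → ∀ y : ℝ, Y ≤ y →
      normalDensity y + (1 - |β|) / 4 * Δ * (qz Δ y * (y ^ 3)⁻¹) ≤ hD β Δ y := by
  have hb' := hb.le
  obtain ⟨CS, hCS, HS⟩ := (FS.Ss 3 hb').ft (by norm_num)
  obtain ⟨CW, hCW, HW⟩ := (FS.wd 4 hb').ft (by norm_num)
  set δ := 1 - |β| with hδ
  have hδ0 : 0 < δ := by linarith
  have hδ1 : δ ≤ 1 := by have := abs_nonneg β; linarith
  refine ⟨4 * (481 + CW) / δ, ?_, min (δ / 8) (δ / (4 * (CS + 1))), by positivity, ?_,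
    fun Δ h1 hD' y hy => ?_⟩
  · rw [le_div_iff₀ hδ0]; linarith
  · exact (min_le_left _ _).trans (by linarith)
  have hd2 : Δ ≤ δ / 8 := hD'.trans (min_le_left _ _)
  have hd3 : Δ ≤ δ / (4 * (CS + 1)) := hD'.trans (min_le_right _ _)
  have h2 : Δ ≤ 1 / 8 := by linarith
  have hy1 : 1 ≤ y := le_trans (by rw [le_div_iff₀ hδ0]; linarith) hy
  have hy0 : 0 < y := by linarith
  have hay : |y| = y := abs_of_pos hy0
  rw [div_le_iff₀ hδ0] at hy
  rw [le_div_iff₀ (by positivity)] at hd3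
  have hyinv : (481 + CW) * (1 / y) ≤ δ / 4 := by
    rw [mul_one_div, div_le_iff₀ hy0]; linarith
  have hiy : 0 < 1 / y := by positivity
  have hd1 : 1 / y ≤ δ / 4 := by nlinarith
  have hq := one_le_qz h1 y
  set q := qz Δ y with hqdef
  set P := (y ^ 3)⁻¹ with hP
  have hP0 : 0 < P := by positivity
  have a1 := HS Δ h1 h2 y
  have a2 := HW Δ h1 h2 y
  rw [hay] at a1 a2
  have b1 : ‖Ft (Ss β Δ) y‖ ≤ CS * Δ ^ 2 * P := by
    rw [hP, ← div_eq_mul_inv, le_div_iff₀ (by positivity)]; linarith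
  have b2 : ‖Ft (fun t => ww β Δ t * dd t) y‖ ≤ CW * Δ * (P * (1 / y)) := by
    have : P * (1 / y) = (y ^ 4)⁻¹ := by rw [hP]; field_simp
    rw [this, ← div_eq_mul_inv, le_div_iff₀ (by positivity)]
    rw [pow_one] at a2; linarith
  have im := im_kw hb' h1 h2 hy1 hd1 hd2
  have ok := one_sub_kw hb' h1 h2 hy1
  set κω := kap β Δ * ((gam Δ : ℂ) / 2 * zD Δ y) with hκω
  have hκωn : ‖κω‖ ≤ 2 * (1 * q) := by
    obtain ⟨g1, g2⟩ := gam_bounds h1 h2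
    have hg2 : ‖(gam Δ : ℂ) / 2‖ ≤ 1 := by
      have : (gam Δ : ℂ) / 2 = ((gam Δ / 2 : ℝ) : ℂ) := by push_cast; rfl
      rw [this, Complex.norm_real, Real.norm_of_nonneg (by linarith)]; linarith
    have k2 := kap_norm hb' h1 h2
    rw [hκω, norm_mul, norm_mul, norm_zD]
    gcongr
  have mr := main_rat hy1
  set R := ((zz y) ^ 3)⁻¹ + 3 * ((zz y) ^ 4)⁻¹ - Complex.I * ((P : ℝ) : ℂ) with hR
  have n4 := norm_inv_zz_pow (by rw [hay]; exact hy0) 4 (y := y)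
  rw [hay] at n4
  have eW : Ft (fun t => ww β Δ t * cc t) y = 2 * (Complex.I * ((P : ℝ) : ℂ) * (1 - κω)
      + (R * (1 - κω) + κω * Δ * ((zz y) ^ 4)⁻¹)) := by
    rw [Ft_wc h2, hR]; ring
  have hP4 : (y ^ 4)⁻¹ = P * (1 / y) := by rw [hP]; field_simp
  have hP5 : (y ^ 5)⁻¹ * y = P * (1 / y) := by rw [hP]; field_simp
  have hsmall : ‖R * (1 - κω) + κω * Δ * ((zz y) ^ 4)⁻¹‖ ≤ 240 * (Δ * q * (P * (1 / y))) := by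
    refine (norm_add_le _ _).trans ?_
    have c1 : ‖R * (1 - κω)‖ ≤ 17 * (y ^ 5)⁻¹ * (14 * (Δ * q * y)) := by
      rw [norm_mul]; gcongr
    have c2 : ‖κω * Δ * ((zz y) ^ 4)⁻¹‖ ≤ 2 * (1 * q) * Δ * (y ^ 4)⁻¹ := by
      rw [norm_mul, norm_mul, Complex.norm_real, Real.norm_of_nonneg h1.le]; gcongr
    calc _ ≤ 17 * (y ^ 5)⁻¹ * (14 * (Δ * q * y)) + 2 * (1 * q) * Δ * (y ^ 4)⁻¹ := add_le_add c1 c2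
      _ = 238 * (Δ * q * ((y ^ 5)⁻¹ * y)) + 2 * (Δ * q * (y ^ 4)⁻¹) := by ring
      _ = _ := by rw [hP4, hP5]; ring
  have hW : 2 * (P * (3 / 4 * (q * (Δ * δ))) - 240 * (Δ * q * (P * (1 / y))))
      ≤ (Ft (fun t => ww β Δ t * cc t) y).re := by
    rw [eW]
    have r1 : (2 * (Complex.I * ((P : ℝ) : ℂ) * (1 - κω)
      + (R * (1 - κω) + κω * Δ * ((zz y) ^ 4)⁻¹))).re = 2 * (P * κω.im
        + (R * (1 - κω) + κω * Δ * ((zz y) ^ 4)⁻¹).re) := by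
      have : Complex.I * ((P : ℝ) : ℂ) * (1 - κω) = (P : ℂ) * (Complex.I * (1 - κω)) := by ring
      rw [this, show (2 : ℂ) = ((2 : ℝ) : ℂ) by norm_num, Complex.re_ofReal_mul, Complex.add_re,
        Complex.re_ofReal_mul, Complex.I_mul_re, Complex.sub_im, Complex.one_im]
      ring
    rw [r1]
    have r2 := Complex.abs_re_le_norm (R * (1 - κω) + κω * Δ * ((zz y) ^ 4)⁻¹)
    have r3 := neg_abs_le (R * (1 - κω) + κω * Δ * ((zz y) ^ 4)⁻¹).re
    have r4 : P * (3 / 4 * (q * (Δ * δ))) ≤ P * κω.im := by gcongr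
    linarith
  have j1 := (FS.Ss 0 hb').integrableOn (by norm_num) h1 h2
  have j2 := (FS.wd 0 hb').integrableOn (by norm_num) h1 h2
  have j0 := (FS.rho 0 hb').integrableOn (by norm_num) h1 h2
  have j3 : IntegrableOn (fun t => ww β Δ t * cc t) (Ioi 0) := by
    refine ((j0.sub j1).sub j2).congr (Eventually.of_forall fun t => ?_)
    simp only [Pi.sub_apply, Ss, dd]; ring
  have j12 : IntegrableOn (fun t => Ss β Δ t + ww β Δ t * dd t) (Ioi 0) := j1.add j2
  have eR : Ft (rho β Δ) y = Ft (Ss β Δ) y + Ft (fun t => ww β Δ t * dd t) y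
      + Ft (fun t => ww β Δ t * cc t) y := by
    rw [← Ft_add j1 j2, ← Ft_add j12 j3]
    refine Ft_congr (fun t ht => ?_) y
    simp only [Ss, dd]; ring
  have hsub := hD_sub hb' h1 h2 y
  have m1 := Complex.abs_re_le_norm (Ft (Ss β Δ) y)
  have m2 := Complex.abs_re_le_norm (Ft (fun t => ww β Δ t * dd t) y)
  have m3 := neg_abs_le (Ft (Ss β Δ) y).re
  have m4 := neg_abs_le (Ft (fun t => ww β Δ t * dd t) y).re
  have key : δ * (Δ * q * P) ≤ (Ft (rho β Δ) y).re := by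
    rw [eR, Complex.add_re, Complex.add_re]
    have u := key_arith hCS hCW h1 hq hP0 hiy hd3 hyinv
    have e9 : P * (3 / 4 * (q * (Δ * δ))) = 3 / 4 * (δ * (Δ * q * P)) := by ring
    rw [e9] at hW
    linarith only [u, m1, m2, m3, m4, b1, b2, hW]
  have hpi4 : 1 / 4 ≤ 1 / Real.pi := by
    have := Real.pi_lt_d2
    have := Real.pi_pos
    gcongr; linarith
  have : 1 / 4 * (δ * (Δ * q * P)) ≤ 1 / Real.pi * (Ft (rho β Δ) y).re := by
    gcongr
  rw [← hsub] at this
  have e10 : δ / 4 * Δ * (q * P) = 1 / 4 * (δ * (Δ * q * P)) := by ring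
  rw [e10]; linarith only [this]

lemma hD_neg (β Δ y : ℝ) : hD β Δ (-y) = hD (-β) Δ y := by
  unfold hD Ft
  congr 1
  have : (∫ t in Ioi (0 : ℝ), Complex.exp (-(Complex.I * (t : ℂ) * ((-y : ℝ) : ℂ))) * phi β Δ t)
      = (starRingEnd ℂ) (∫ t in Ioi (0 : ℝ),
          Complex.exp (-(Complex.I * (t : ℂ) * (y : ℂ))) * phi (-β) Δ t) := by
    rw [← integral_conj]
    congr 1; ext t
    rw [map_mul]
    unfold phi kap
    rw [← Complex.exp_conj, ← Complex.exp_conj]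
    simp
  rw [this, Complex.conj_re]

lemma lower {β : ℝ} (hb : |β| < 1) : ∃ c : ℝ, 0 < c ∧ ∃ Y : ℝ, 1 ≤ Y ∧ ∃ D : ℝ, 0 < D ∧
    D ≤ 1 / 8 ∧ ∀ Δ, 0 < Δ → Δ ≤ D → ∀ y : ℝ, Y ≤ |y| →
      normalDensity y + c * Δ * (qz Δ y * (|y| ^ 3)⁻¹) ≤ hD β Δ y := by
  obtain ⟨Y1, hY1, D1, hD1, hD1', H1⟩ := lower_pos hb
  obtain ⟨Y2, hY2, D2, hD2, hD2', H2⟩ := lower_pos (β := -β) (by rwa [abs_neg])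
  refine ⟨(1 - |β|) / 4, by linarith, max Y1 Y2, le_max_of_le_left hY1, min D1 D2,
    lt_min hD1 hD2, (min_le_left _ _).trans hD1', fun Δ h1 h2 y hy => ?_⟩
  rcases abs_cases y with ⟨e, h⟩ | ⟨e, h⟩
  · rw [e] at hy ⊢
    exact H1 Δ h1 (h2.trans (min_le_left _ _)) y ((le_max_left _ _).trans hy)
  · rw [e] at hy ⊢
    have := H2 Δ h1 (h2.trans (min_le_right _ _)) (-y) ((le_max_right _ _).trans hy)
    rw [hD_neg, neg_neg, qz_neg, abs_neg] at this
    have eG : normalDensity (-y) = normalDensity y := by unfold normalDensity; rw [neg_sq]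
    rwa [eG] at this

lemma tail_abs {f s b G C c Δ q Y : ℝ} (hC : 0 ≤ C) (hc : 0 < c) (hΔ : 0 < Δ) (hq : 1 ≤ q)
    (hY : 1 ≤ Y) (hG : 0 < G) (hf : G + c * Δ * (q * (Y ^ 3)⁻¹) ≤ f)
    (hs : |s| ≤ 2 * Y ^ 2 * G + 3 * C * Δ * (Y ^ 2)⁻¹) (hb : |b| ≤ C * Δ * (q * (Y ^ 3)⁻¹)) :
    |s * b / f| ≤ (2 + 3 * C / c) * C * Δ * q * Y⁻¹ ∧
    (2 * Y ^ 2 * G ≤ 256 * Δ * (Y ^ 2)⁻¹ → |s * b / f| ≤ C / c * (256 + 3 * C) * Δ * (Y ^ 2)⁻¹) := by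
  have hY0 : 0 < Y := by linarith
  have hp : 0 < q * (Y ^ 3)⁻¹ := by positivity
  have hcp : 0 < c * Δ * (q * (Y ^ 3)⁻¹) := by positivity
  have hf0 : 0 < f := by linarith
  rw [abs_div, abs_mul, abs_of_pos hf0, div_le_iff₀ hf0]
  constructor
  · have h1 : |s| ≤ (2 + 3 * C / c) * Y ^ 2 * f := by
      have h2 : Δ * (Y ^ 2)⁻¹ ≤ Y ^ 2 * (Δ * (q * (Y ^ 3)⁻¹)) := by
        have : Y ^ 2 * (Δ * (q * (Y ^ 3)⁻¹)) = Δ * (q * Y) * (Y ^ 2)⁻¹ := by field_simp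
        rw [this]
        have : 1 ≤ q * Y := one_le_mul_of_one_le_of_one_le hq hY
        gcongr
        nlinarith
      calc |s| ≤ 2 * Y ^ 2 * G + 3 * C * (Δ * (Y ^ 2)⁻¹) := by linarith
        _ ≤ 2 * Y ^ 2 * G + 3 * C * (Y ^ 2 * (Δ * (q * (Y ^ 3)⁻¹))) := by gcongr
        _ = 2 * Y ^ 2 * G + (3 * C / c) * Y ^ 2 * (c * Δ * (q * (Y ^ 3)⁻¹)) := by field_simp
        _ ≤ (2 + 3 * C / c) * Y ^ 2 * (G + c * Δ * (q * (Y ^ 3)⁻¹)) := by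
          have e1 : 0 ≤ 2 * Y ^ 2 * (c * Δ * (q * (Y ^ 3)⁻¹)) := by positivity
          have e2 : 0 ≤ (3 * C / c) * Y ^ 2 * G := by positivity
          nlinarith
        _ ≤ _ := by gcongr
    calc |s| * |b| ≤ (2 + 3 * C / c) * Y ^ 2 * f * (C * Δ * (q * (Y ^ 3)⁻¹)) := by gcongr
      _ = _ := by field_simp
  · intro h
    rw [div_le_iff₀ hf0]
    have h1 : |b| ≤ C / c * f := by
      calc |b| ≤ C / c * (c * Δ * (q * (Y ^ 3)⁻¹)) := by
            refine hb.trans (le_of_eq ?_); field_simp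
        _ ≤ _ := by gcongr; linarith
    calc |s| * |b| ≤ ((256 + 3 * C) * Δ * (Y ^ 2)⁻¹) * (C / c * f) := by
          gcongr; linarith
      _ = _ := by ring

lemma G_pos (y : ℝ) : 0 < normalDensity y := by unfold normalDensity; positivity

lemma g0_bounds : 1 / 4 ≤ 1 / (2 * Real.sqrt Real.pi) ∧ 1 / (2 * Real.sqrt Real.pi) ≤ 1 := by
  have h1 : 1 ≤ Real.sqrt Real.pi := Real.one_le_sqrt.2 (by linarith [Real.pi_gt_three])
  have h2 : Real.sqrt Real.pi ≤ 2 := by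
    rw [Real.sqrt_le_left (by norm_num)]; linarith [Real.pi_lt_d2]
  constructor
  · gcongr; linarith
  · rw [div_le_one (by linarith)]; linarith

lemma G_le_exp (y : ℝ) : normalDensity y ≤ Real.exp (-(y ^ 2) / 4) := by
  unfold normalDensity
  have := g0_bounds.2
  have := Real.exp_pos (-(y ^ 2) / 4)
  nlinarith

lemma G_le_one (y : ℝ) : normalDensity y ≤ 1 :=
  (G_le_exp y).trans (Real.exp_le_one_iff.2 (by nlinarith [sq_nonneg y]))

lemma G_ge_exp (y : ℝ) : 1 / 4 * Real.exp (-(y ^ 2) / 4) ≤ normalDensity y := by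
  unfold normalDensity
  have := g0_bounds.1
  gcongr

lemma G_tail {y L : ℝ} (hL : 0 ≤ L) (hy : 9 * L ≤ y ^ 2) (hy0 : 0 < |y|) :
    2 * |y| ^ 2 * normalDensity y ≤ 256 * Real.exp (-L) * (|y| ^ 2)⁻¹ := by
  rw [← div_eq_mul_inv, le_div_iff₀ (by positivity), sq_abs]
  have h1 := G_le_exp y
  have e : Real.exp (-(y ^ 2) / 4) = Real.exp (-(y ^ 2 / 8)) * Real.exp (-(y ^ 2 / 8)) := by
    rw [← Real.exp_add]; congr 1; ring
  have h2 : Real.exp (-(y ^ 2 / 8)) ≤ Real.exp (-L) := Real.exp_le_exp.2 (by linarith)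
  have h3 : (y ^ 2) ^ 2 * Real.exp (-(y ^ 2 / 8)) ≤ 128 := by
    have h := Real.quadratic_le_exp_of_nonneg (show 0 ≤ y ^ 2 / 8 by positivity)
    have h5 : (y ^ 2) ^ 2 ≤ 128 * Real.exp (y ^ 2 / 8) := by nlinarith [sq_nonneg y]
    rw [Real.exp_neg, ← div_eq_mul_inv, div_le_iff₀ (Real.exp_pos _)]
    exact h5
  have hE := Real.exp_pos (-L)
  calc 2 * y ^ 2 * normalDensity y * y ^ 2
      ≤ 2 * y ^ 2 * (Real.exp (-(y ^ 2 / 8)) * Real.exp (-(y ^ 2 / 8))) * y ^ 2 := by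
        rw [← e]; gcongr
    _ = 2 * ((y ^ 2) ^ 2 * Real.exp (-(y ^ 2 / 8))) * Real.exp (-(y ^ 2 / 8)) := by ring
    _ ≤ 2 * 128 * Real.exp (-L) := by gcongr
    _ = _ := by ring

noncomputable def Hh (β Δ x : ℝ) : ℝ :=
  fSig (2 - Δ) β x * fBeta (2 - Δ) β x / stableDensity (2 - Δ) β x

noncomputable def sS (β Δ x y : ℝ) : ℝ := -hD β Δ y - x * hX β Δ y

lemma Hh_eq {β Δ : ℝ} (hb : |β| ≤ 1) (h1 : 0 < Δ) (h2 : Δ ≤ 1 / 8) (x : ℝ) :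
    fSig (2 - Δ) β x = sS β Δ x (x - β * Tt Δ) ∧
    fBeta (2 - Δ) β x = hB β Δ (x - β * Tt Δ) ∧
    stableDensity (2 - Δ) β x = hD β Δ (x - β * Tt Δ) := by
  refine ⟨?_, fBeta_eq β h1 h2 x, sd_eq β Δ x⟩
  unfold fSig sS
  rw [sd_eq, fX_eq β hb h1 h2]; rfl

lemma bT_le {β Δ : ℝ} (hb : |β| ≤ 1) (h1 : 0 < Δ) (h2 : Δ ≤ 1 / 8) : |β * Tt Δ| ≤ 2 * Δ := by
  obtain ⟨t1, t2⟩ := Tt_bounds h1 h2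
  rw [abs_mul, abs_of_nonneg (show 0 ≤ Tt Δ by linarith)]
  nlinarith [abs_nonneg β]

lemma sS_le {C β Δ x y : ℝ} (hC : 0 ≤ C) (h1 : 0 < Δ) (hy : 1 ≤ |y|) (hxy : |x| ≤ 2 * |y|)
    (b1 : y ^ 2 * |hD β Δ y - normalDensity y| ≤ C * Δ)
    (b2 : |y| ^ 3 * |hX β Δ y + y / 2 * normalDensity y| ≤ C * Δ) :
    |sS β Δ x y| ≤ 2 * |y| ^ 2 * normalDensity y + 3 * C * Δ * (|y| ^ 2)⁻¹ := by
  have hy0 : 0 < |y| := by linarith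
  have hG := G_pos y
  have e : sS β Δ x y = (x * y / 2 - 1) * normalDensity y - (hD β Δ y - normalDensity y)
      - x * (hX β Δ y + y / 2 * normalDensity y) := by unfold sS; ring
  have c1 : |hD β Δ y - normalDensity y| ≤ C * Δ * (|y| ^ 2)⁻¹ := by
    rw [← div_eq_mul_inv, le_div_iff₀ (by positivity), sq_abs]; linarith
  have c2 : |x * (hX β Δ y + y / 2 * normalDensity y)| ≤ 2 * (C * Δ * (|y| ^ 2)⁻¹) := by
    rw [abs_mul]
    have : |hX β Δ y + y / 2 * normalDensity y| ≤ C * Δ * (|y| ^ 3)⁻¹ := by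
      rw [← div_eq_mul_inv, le_div_iff₀ (by positivity)]; linarith
    calc _ ≤ 2 * |y| * (C * Δ * (|y| ^ 3)⁻¹) := by gcongr
      _ = _ := by field_simp
  have c3 : |(x * y / 2 - 1) * normalDensity y| ≤ 2 * |y| ^ 2 * normalDensity y := by
    rw [abs_mul, abs_of_pos hG]
    gcongr
    refine (abs_sub _ _).trans ?_
    rw [abs_div, abs_mul, abs_one, abs_of_pos (show (0:ℝ) < 2 by norm_num)]
    nlinarith
  rw [e]
  refine (abs_sub _ _).trans ?_
  have := abs_sub ((x * y / 2 - 1) * normalDensity y) (hD β Δ y - normalDensity y)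
  linarith

/-- The core estimate for one point. -/
lemma core_one {C β Δ x y E : ℝ} (hC : 0 ≤ C) (h1 : 0 < Δ) (hxy : |x - y| ≤ 2 * Δ) (hE : 0 < E)
    (a0 : |hD β Δ y - normalDensity y| ≤ C * Δ)
    (b0 : |hX β Δ y + y / 2 * normalDensity y| ≤ C * Δ)
    (d0 : |hB β Δ y| ≤ C * Δ) (hG : E / 8 ≤ normalDensity y) (hCE : 16 * C * Δ ≤ E) :
    |sS β Δ x y * hB β Δ y / hD β Δ y - (x ^ 2 / 2 - 1) * hB β Δ y|
      ≤ 16 * C * (C + 1) * (1 + |x|) ^ 2 * Δ ^ 2 / E := by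
  have hf : E / 16 ≤ hD β Δ y := by
    have := neg_abs_le (hD β Δ y - normalDensity y); linarith
  have hf0 : 0 < hD β Δ y := by linarith
  have hG0 := G_pos y
  have hG1 := G_le_one y
  have e : sS β Δ x y * hB β Δ y / hD β Δ y - (x ^ 2 / 2 - 1) * hB β Δ y
      = -(x * ((hX β Δ y + y / 2 * normalDensity y) + x / 2 * (hD β Δ y - normalDensity y)
        + (x - y) / 2 * normalDensity y)) * hB β Δ y / hD β Δ y := by
    unfold sS; field_simp; ring
  have c1 : |(hX β Δ y + y / 2 * normalDensity y) + x / 2 * (hD β Δ y - normalDensity y)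
        + (x - y) / 2 * normalDensity y| ≤ (C + 1) * Δ * (1 + |x|) := by
    refine (abs_add_three _ _ _).trans ?_
    rw [abs_mul, abs_mul, abs_div, abs_div, abs_of_pos hG0, abs_of_pos (show (0:ℝ) < 2 by norm_num)]
    have k1 : |x| / 2 * |hD β Δ y - normalDensity y| ≤ |x| / 2 * (C * Δ) := by gcongr
    have k2 : |x - y| / 2 * normalDensity y ≤ 2 * Δ / 2 * 1 := by gcongr
    have k3 : 0 ≤ |x| * (C * Δ) := by positivity
    have k4 : 0 ≤ |x| * Δ := by positivity
    nlinarith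
  rw [e, abs_div, abs_mul, abs_neg, abs_mul, abs_of_pos hf0]
  calc _ ≤ (1 + |x|) * ((C + 1) * Δ * (1 + |x|)) * (C * Δ) / (E / 16) := by
        gcongr; linarith
    _ = _ := by field_simp

/-- All the bounds in one place. -/
lemma all_bounds {β : ℝ} (hb : |β| < 1) : ∃ C c Y D : ℝ, 0 ≤ C ∧ 0 < c ∧ 1 ≤ Y ∧ 0 < D ∧ D ≤ 1 / 8 ∧
    ∀ Δ, 0 < Δ → Δ ≤ D → (∀ y : ℝ, |hD β Δ y - normalDensity y| ≤ C * Δ ∧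
      y ^ 2 * |hD β Δ y - normalDensity y| ≤ C * Δ ∧
      |hX β Δ y + y / 2 * normalDensity y| ≤ C * Δ ∧
      |y| ^ 3 * |hX β Δ y + y / 2 * normalDensity y| ≤ C * Δ ∧ |hB β Δ y| ≤ C * Δ ∧
      |fBeta (2 - Δ) β y + fBeta (2 - Δ) β (-y)| ≤ C * Δ ^ 2 ∧
      (1 ≤ |y| → |hB β Δ y| ≤ C * Δ * (qz Δ y * (|y| ^ 3)⁻¹)) ∧
      (Y ≤ |y| → normalDensity y + c * Δ * (qz Δ y * (|y| ^ 3)⁻¹) ≤ hD β Δ y)) := by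
  obtain ⟨C1, p1, H1⟩ := B1 hb.le
  obtain ⟨C2, p2, H2⟩ := B2 hb.le
  obtain ⟨C3, p3, H3⟩ := B3a hb.le
  obtain ⟨C4, p4, H4⟩ := B3b hb.le
  obtain ⟨C5, p5, H5⟩ := B4 hb.le
  obtain ⟨c, hc, Y, hY, D, hD0, hD8, HL⟩ := lower hb
  refine ⟨C1 + C2 + C3 + C4 + C5, c, Y, D, by positivity, hc, hY, hD0, hD8,
    fun Δ h1 h2 y => ?_⟩
  have h8 := h2.trans hD8
  obtain ⟨a1, a2⟩ := H1 Δ h1 h8 y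
  obtain ⟨a3, a4⟩ := H2 Δ h1 h8 y
  have a5 := H3 Δ h1 h8 y
  have a6 := H5 Δ h1 h8 y
  refine ⟨a1.trans ?_, a2.trans ?_, a3.trans ?_, a4.trans ?_, a5.trans ?_, a6.trans ?_,
    fun hy => (H4 Δ h1 h8 y hy).trans ?_, fun hy => HL Δ h1 h2 y hy⟩
  iterate 6 (gcongr; linarith)
  have := one_le_qz h1 y
  gcongr; linarith

lemma qz_le_three {Δ y : ℝ} (h1 : 0 < Δ) (h : Δ * (1 + |y|) ≤ 1) : qz Δ y ≤ 3 := by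
  unfold qz
  have h2 := one_le_norm_zz y
  have h3 := Real.log_le_sub_one_of_pos (show 0 < ‖zz y‖ by linarith)
  have h4 := norm_zz_le y
  have h5 : Δ * Real.log ‖zz y‖ ≤ 1 := by nlinarith
  calc _ ≤ Real.exp 1 := Real.exp_le_exp.2 h5
    _ ≤ 3 := by linarith [Real.exp_one_lt_d9]

noncomputable def MM (s x : ℝ) : ℝ :=
  (1 + x ^ 2)⁻¹ + (Icc (-(4 * s)) (4 * s)).indicator (fun _ => s⁻¹) x

set_option maxHeartbeats 4000000 in
lemma pointwise {β : ℝ} (hb : |β| < 1) : ∃ K : ℝ, 0 ≤ K ∧ ∃ L0 : ℝ, ∀ L, L0 ≤ L → ∀ x : ℝ,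
    |Hh β (Real.exp (-L)) x + Hh β (Real.exp (-L)) (-x)|
      ≤ K * Real.exp (-L) * MM (Real.sqrt L) x := by
  obtain ⟨C, c, Y, D, hC, hc, hY, hD0, hD8, H⟩ := all_bounds hb
  have t1 : Tendsto (fun L : ℝ => Real.exp (-L)) atTop (𝓝 0) := Real.tendsto_exp_neg_atTop_nhds_zero
  have t2 : Tendsto (fun L : ℝ => (1 + L) ^ 2 * (Real.exp (-L / 4)) ^ 3) atTop (𝓝 0) := by
    have h := (Real.tendsto_pow_mul_exp_neg_atTop_nhds_zero 2).comp
      (tendsto_atTop_add_const_left atTop (1 : ℝ)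
        (tendsto_id.const_mul_atTop (show (0 : ℝ) < 3 / 4 by norm_num)))
    have h' := h.const_mul ((16 / 9 : ℝ) * Real.exp 1)
    rw [mul_zero] at h'
    refine squeeze_zero' ((eventually_ge_atTop 0).mono fun L hL => by positivity) ?_ h'
    filter_upwards [eventually_ge_atTop 0] with L hL
    simp only [Function.comp, id]
    have e : (Real.exp (-L / 4)) ^ 3 = Real.exp 1 * Real.exp (-(1 + 3 / 4 * L)) := by
      rw [← Real.exp_nat_mul, ← Real.exp_add]; congr 1; push_cast; ring
    rw [e]
    have hE := Real.exp_pos (-(1 + 3 / 4 * L))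
    have hE1 := Real.exp_pos 1
    have : (1 + L) ^ 2 ≤ 16 / 9 * (1 + 3 / 4 * L) ^ 2 := by nlinarith
    calc _ ≤ 16 / 9 * (1 + 3 / 4 * L) ^ 2 * (Real.exp 1 * Real.exp (-(1 + 3 / 4 * L))) := by gcongr
      _ = _ := by ring
  have t3 : Tendsto (fun L : ℝ => 16 * C * (Real.exp (-L / 4)) ^ 3) atTop (𝓝 0) := by
    have h := (Real.tendsto_exp_neg_atTop_nhds_zero).comp
      (tendsto_id.const_mul_atTop (show (0 : ℝ) < 3 / 4 by norm_num))
    have h' := h.const_mul (16 * C)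
    rw [mul_zero] at h'
    refine h'.congr fun L => ?_
    simp only [Function.comp, id]
    rw [← Real.exp_nat_mul]; congr 2; push_cast; ring
  have ev := (((t1.eventually_le_const hD0).and (t2.eventually_le_const (show (0:ℝ) < 1 by norm_num))).and
    (t3.eventually_le_const (show (0:ℝ) < 1 by norm_num))).and (eventually_ge_atTop (4 * Y ^ 2))
  obtain ⟨L0, hL0⟩ := eventually_atTop.1 ev
  -- one-sided tail bound
  have KT : ∃ K : ℝ, 0 ≤ K ∧ ∀ L, L0 ≤ L → ∀ x : ℝ, Real.sqrt L ≤ |x| →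
      |Hh β (Real.exp (-L)) x| ≤ K * Real.exp (-L) * MM (Real.sqrt L) x := by
    refine ⟨(2 + 3 * C / c) * C * 6 + C / c * (256 + 3 * C) * 8, by positivity, fun L hL x hx => ?_⟩
    obtain ⟨⟨⟨e1, e2⟩, e3⟩, e4⟩ := hL0 L hL
    have h1 := Real.exp_pos (-L)
    have h8 := e1.trans hD8
    have hL4 : 4 ≤ L := by nlinarith
    have hE4 : Real.exp (-L) ≤ (Real.exp (-L / 4)) ^ 3 := by
      rw [← Real.exp_nat_mul]; apply Real.exp_le_exp.2; push_cast; linarith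
    set Δ := Real.exp (-L) with hΔ
    set s := Real.sqrt L with hs
    have hss : s ^ 2 = L := Real.sq_sqrt (by linarith)
    have hsY : 2 * Y ≤ s := Real.le_sqrt_of_sq_le (by nlinarith)
    have hs2 : 2 ≤ s := by linarith
    have hΔs : Δ * (1 + 8 * s) ≤ 1 := by
      have k1 : 1 + 8 * s ≤ (1 + L) ^ 2 := by rw [← hss]; nlinarith [sq_nonneg (s ^ 2 - 4)]
      calc _ ≤ (Real.exp (-L / 4)) ^ 3 * (1 + L) ^ 2 := by gcongr
        _ ≤ 1 := by linarith
    obtain ⟨f1, f2, f3⟩ := Hh_eq hb.le h1 h8 x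
    have hbT := bT_le hb.le h1 h8
    set y := x - β * Tt Δ with hy
    have hxy : |x - y| ≤ 2 * Δ := by rw [hy]; simpa using hbT
    have d1 : |x| ≤ |y| + 1 := by
      have := abs_sub_abs_le_abs_sub x y; linarith
    have d2 : |y| ≤ |x| + 1 := by
      have := abs_sub_abs_le_abs_sub y x; rw [abs_sub_comm y x] at this; linarith
    have hy1 : 1 ≤ |y| := by linarith
    have hyY : Y ≤ |y| := by linarith
    have hx2 : |x| ≤ 2 * |y| := by linarith
    obtain ⟨b1, b2, b3, b4, b5, b6, b7, b8⟩ := H Δ h1 e1 y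
    have hS := sS_le hC h1 hy1 hx2 b2 b4
    obtain ⟨T1, T2⟩ := tail_abs hC hc h1 (one_le_qz h1 y) hy1 (G_pos y) (b8 hyY) hS (b7 hy1)
    have eH : Hh β Δ x = sS β Δ x y * hB β Δ y / hD β Δ y := by
      unfold Hh; rw [f1, f2, f3]
    rw [eH]
    have hy0 : 0 < |y| := by linarith
    have hx0 : 0 < |x| := by linarith
    have hK1 : 0 ≤ (2 + 3 * C / c) * C := by positivity
    have hK2 : 0 ≤ C / c * (256 + 3 * C) := by positivity
    set K1 := (2 + 3 * C / c) * C
    set K2 := C / c * (256 + 3 * C)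
    have hinv : 0 < (1 + x ^ 2)⁻¹ := by positivity
    by_cases hx4 : |x| ≤ 4 * s
    · have hM : s⁻¹ ≤ MM s x := by
        unfold MM
        rw [indicator_of_mem (show x ∈ Icc (-(4 * s)) (4 * s) from abs_le.1 hx4)]
        linarith
      have hq : qz Δ y ≤ 3 := by
        refine qz_le_three h1 ?_
        have : 1 + |y| ≤ 1 + 8 * s := by linarith
        exact (mul_le_mul_of_nonneg_left this h1.le).trans hΔs
      have hyi : |y|⁻¹ ≤ 2 * s⁻¹ := by
        have : 2 * s⁻¹ = (s / 2)⁻¹ := by field_simp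
        rw [this]
        have : 0 < s / 2 := by linarith
        gcongr; linarith
      have hs0 : 0 < s⁻¹ := by positivity
      calc _ ≤ K1 * Δ * qz Δ y * |y|⁻¹ := T1
        _ ≤ K1 * Δ * 3 * (2 * s⁻¹) := by gcongr
        _ = (K1 * 6) * Δ * s⁻¹ := by ring
        _ ≤ (K1 * 6 + K2 * 8) * Δ * MM s x := by gcongr; linarith
    · push Not at hx4
      have hM : (1 + x ^ 2)⁻¹ ≤ MM s x := by
        unfold MM
        have : 0 ≤ (Icc (-(4 * s)) (4 * s)).indicator (fun _ => s⁻¹) x :=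
          indicator_nonneg (fun _ _ => by positivity) x
        linarith
      have hy3 : 3 * s ≤ |y| := by linarith
      have hy9 : 9 * L ≤ y ^ 2 := by rw [← sq_abs y, ← hss]; nlinarith
      have hT := T2 (G_tail (by linarith) hy9 hy0)
      have hyi : (|y| ^ 2)⁻¹ ≤ 8 * (1 + x ^ 2)⁻¹ := by
        rw [← div_eq_mul_inv, inv_eq_one_div, div_le_div_iff₀ (by positivity) (by positivity),
          ← sq_abs x]
        nlinarith
      calc _ ≤ K2 * Δ * (|y| ^ 2)⁻¹ := hT
        _ ≤ K2 * Δ * (8 * (1 + x ^ 2)⁻¹) := by gcongr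
        _ = (K2 * 8) * Δ * (1 + x ^ 2)⁻¹ := by ring
        _ ≤ (K1 * 6 + K2 * 8) * Δ * MM s x := by gcongr; linarith
  have KC : ∃ K : ℝ, 0 ≤ K ∧ ∀ L, L0 ≤ L → ∀ x : ℝ, |x| ≤ Real.sqrt L →
      |Hh β (Real.exp (-L)) x + Hh β (Real.exp (-L)) (-x)|
        ≤ K * Real.exp (-L) * MM (Real.sqrt L) x := by
    refine ⟨C + 64 * C * (C + 1), by positivity, fun L hL x hx => ?_⟩
    obtain ⟨⟨⟨e1, e2⟩, e3⟩, e4⟩ := hL0 L hL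
    have h1 := Real.exp_pos (-L)
    have h8 := e1.trans hD8
    have hL4 : 4 ≤ L := by nlinarith
    have hE0 := Real.exp_pos (-L / 4)
    have hE4 : Real.exp (-L) = (Real.exp (-L / 4)) ^ 4 := by
      rw [← Real.exp_nat_mul]; congr 1; push_cast; ring
    have hE1 : Real.exp (-L / 4) ≤ 1 := Real.exp_le_one_iff.2 (by linarith)
    set E := Real.exp (-L / 4) with hE
    set Δ := Real.exp (-L) with hΔ
    set s := Real.sqrt L with hs
    have hss : s ^ 2 = L := Real.sq_sqrt (by linarith)
    have hs2 : 2 ≤ s := Real.le_sqrt_of_sq_le (by linarith)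
    have hx2 : x ^ 2 ≤ L := by rw [← hss, ← sq_abs x]; gcongr
    have hΔE : Δ ≤ E ^ 3 := by rw [hE4]; exact pow_le_pow_of_le_one hE0.le hE1 (by norm_num)
    have hΔs : Δ * (1 + 8 * s) ≤ 1 := by
      have k1 : 1 + 8 * s ≤ (1 + L) ^ 2 := by rw [← hss]; nlinarith [sq_nonneg (s ^ 2 - 4)]
      calc _ ≤ E ^ 3 * (1 + L) ^ 2 := by gcongr
        _ ≤ 1 := by linarith
    have hCE : 16 * C * Δ ≤ E := by
      calc 16 * C * Δ = 16 * C * E ^ 3 * E := by rw [hE4]; ring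
        _ ≤ 1 * E := by gcongr
        _ = E := one_mul E
    have one : ∀ x : ℝ, |x| ≤ s → |Hh β Δ x - (x ^ 2 / 2 - 1) * fBeta (2 - Δ) β x|
        ≤ 32 * C * (C + 1) * (1 + L) * Δ ^ 2 / E := by
      intro x hx
      obtain ⟨f1, f2, f3⟩ := Hh_eq hb.le h1 h8 x
      have hbT := bT_le hb.le h1 h8
      unfold Hh
      rw [f1, f2, f3]
      set y := x - β * Tt Δ with hy
      have hxy : |x - y| ≤ 2 * Δ := by rw [hy]; simpa using hbT
      obtain ⟨b1, b2, b3, b4, b5, b6, b7, b8⟩ := H Δ h1 e1 y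
      have hy2 : y ^ 2 ≤ L + 1 := by
        have d2 : |y| ≤ s + 2 * Δ := by
          have := abs_sub_abs_le_abs_sub y x; rw [abs_sub_comm y x] at this; linarith
        rw [← sq_abs y]
        calc |y| ^ 2 ≤ (s + 2 * Δ) ^ 2 := by gcongr
          _ ≤ _ := by rw [← hss]; nlinarith
      have hG : E / 8 ≤ normalDensity y := by
        refine le_trans ?_ (G_ge_exp y)
        have : Real.exp (-(L + 1) / 4) ≤ Real.exp (-(y ^ 2) / 4) :=
          Real.exp_le_exp.2 (by linarith)
        have e5 : Real.exp (-(L + 1) / 4) = E * Real.exp (-1 / 4) := by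
          rw [hE, ← Real.exp_add]; congr 1; ring
        have e6 : 1 / 2 ≤ Real.exp (-1 / 4) := by
          have := Real.add_one_le_exp (-1 / 4 : ℝ); linarith
        nlinarith
      refine (core_one hC h1 hxy hE0 b1 b3 b5 hG hCE).trans ?_
      have : (1 + |x|) ^ 2 ≤ 2 * (1 + L) := by
        have : (1 + |x|) ^ 2 ≤ (1 + s) ^ 2 := by gcongr
        nlinarith [sq_nonneg (1 - s)]
      calc _ ≤ 16 * C * (C + 1) * (2 * (1 + L)) * Δ ^ 2 / E := by gcongr
        _ = _ := by ring
    have o1 := one x hx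
    have o2 := one (-x) (by rwa [abs_neg])
    have b6 := (H Δ h1 e1 x).2.2.2.2.2.1
    rw [neg_sq] at o2
    have eS : Hh β Δ x + Hh β Δ (-x) = (Hh β Δ x - (x ^ 2 / 2 - 1) * fBeta (2 - Δ) β x)
        + (Hh β Δ (-x) - (x ^ 2 / 2 - 1) * fBeta (2 - Δ) β (-x))
        + (x ^ 2 / 2 - 1) * (fBeta (2 - Δ) β x + fBeta (2 - Δ) β (-x)) := by ring
    have o3 : |(x ^ 2 / 2 - 1) * (fBeta (2 - Δ) β x + fBeta (2 - Δ) β (-x))|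
        ≤ (1 + L) * (C * Δ ^ 2) := by
      rw [abs_mul]
      have : |x ^ 2 / 2 - 1| ≤ 1 + L := by
        rw [abs_le]; constructor <;> nlinarith [sq_nonneg x]
      gcongr
    have hdE : Δ ^ 2 / E = Δ * E ^ 3 := by
      rw [div_eq_iff hE0.ne', sq]; nth_rewrite 2 [hE4]; ring
    have hd2 : Δ ^ 2 ≤ Δ * E ^ 3 := by rw [sq]; gcongr
    have hM : (1 + L)⁻¹ ≤ MM s x := by
      unfold MM
      have : 0 ≤ (Icc (-(4 * s)) (4 * s)).indicator (fun _ => s⁻¹) x :=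
        indicator_nonneg (fun _ _ => by positivity) x
      have : (1 + L)⁻¹ ≤ (1 + x ^ 2)⁻¹ := by gcongr
      linarith
    have hLE : (1 + L) * E ^ 3 ≤ (1 + L)⁻¹ := by
      rw [inv_eq_one_div, le_div_iff₀ (by linarith)]; linarith
    rw [eS]
    refine (abs_add_three _ _ _).trans ?_
    calc _ ≤ 32 * C * (C + 1) * (1 + L) * Δ ^ 2 / E + 32 * C * (C + 1) * (1 + L) * Δ ^ 2 / E
          + (1 + L) * (C * Δ ^ 2) := add_le_add (add_le_add o1 o2) o3
      _ = 64 * C * (C + 1) * (1 + L) * (Δ ^ 2 / E) + (1 + L) * C * Δ ^ 2 := by ring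
      _ ≤ 64 * C * (C + 1) * (1 + L) * (Δ * E ^ 3) + (1 + L) * C * (Δ * E ^ 3) := by
        rw [hdE]; gcongr
      _ = (C + 64 * C * (C + 1)) * Δ * ((1 + L) * E ^ 3) := by ring
      _ ≤ (C + 64 * C * (C + 1)) * Δ * MM s x := by gcongr; exact hLE.trans hM
  obtain ⟨K1, hK1, H1⟩ := KT
  obtain ⟨K2, hK2, H2⟩ := KC
  have hMneg : ∀ s x, MM s (-x) = MM s x := by
    intro s x
    unfold MM
    rw [neg_sq]
    congr 1
    by_cases h : x ∈ Icc (-(4 * s)) (4 * s)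
    · rw [indicator_of_mem h, indicator_of_mem]
      exact ⟨by linarith [h.2], by linarith [h.1]⟩
    · rw [indicator_of_notMem h, indicator_of_notMem]
      intro h'; exact h ⟨by linarith [h'.2], by linarith [h'.1]⟩
  refine ⟨2 * K1 + K2, by positivity, L0, fun L hL x => ?_⟩
  have hM0 : 0 ≤ MM (Real.sqrt L) x := by
    unfold MM
    have : 0 ≤ (Icc (-(4 * Real.sqrt L)) (4 * Real.sqrt L)).indicator
      (fun _ => (Real.sqrt L)⁻¹) x := indicator_nonneg (fun _ _ => by positivity) x
    positivity
  have hp : 0 ≤ Real.exp (-L) * MM (Real.sqrt L) x := mul_nonneg (Real.exp_pos _).le hM0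
  rcases le_total |x| (Real.sqrt L) with h | h
  · refine (H2 L hL x h).trans ?_
    nlinarith
  · have a1 := H1 L hL x h
    have a2 := H1 L hL (-x) (by rwa [abs_neg])
    rw [hMneg] at a2
    refine (abs_add_le _ _).trans ?_
    nlinarith

lemma MM_int {s : ℝ} (hs : 0 < s) : Integrable (MM s) ∧ ∫ x, MM s x = Real.pi + 8 := by
  have i1 := integrable_inv_one_add_sq
  have i2 : Integrable ((Icc (-(4 * s)) (4 * s)).indicator (fun _ : ℝ => s⁻¹)) :=
    (integrableOn_const (by simp) (by simp)).integrable_indicator measurableSet_Icc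
  refine ⟨i1.add i2, ?_⟩
  unfold MM
  rw [integral_add i1 i2, integral_univ_inv_one_add_sq, integral_indicator measurableSet_Icc,
    setIntegral_const]
  simp only [Measure.real, Real.volume_Icc, smul_eq_mul]
  rw [ENNReal.toReal_ofReal (by linarith)]
  field_simp; ring

lemma final_bound {β : ℝ} (hb : |β| < 1) : ∃ K : ℝ, ∃ L0 : ℝ, ∀ L, L0 ≤ L →
    |∫ x, Hh β (Real.exp (-L)) x| ≤ K * Real.exp (-L) := by
  obtain ⟨K, hK, L0, H⟩ := pointwise hb
  refine ⟨K * (Real.pi + 8), max L0 1, fun L hL => ?_⟩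
  have hs : 0 < Real.sqrt L := Real.sqrt_pos.2 (by linarith [le_max_right L0 1])
  obtain ⟨m1, m2⟩ := MM_int hs
  have hE := Real.exp_pos (-L)
  have hpi := Real.pi_pos
  by_cases hi : Integrable (Hh β (Real.exp (-L)))
  · have e : 2 * ∫ x, Hh β (Real.exp (-L)) x
        = ∫ x, (Hh β (Real.exp (-L)) x + Hh β (Real.exp (-L)) (-x)) := by
      rw [integral_add hi hi.comp_neg, integral_neg_eq_self]; ring
    have b := norm_integral_le_of_norm_le
      (f := fun x => Hh β (Real.exp (-L)) x + Hh β (Real.exp (-L)) (-x)) (m1.const_mul (K * Real.exp (-L)))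
      (Eventually.of_forall fun x => H L ((le_max_left _ _).trans hL) x)
    rw [← e, integral_const_mul, m2, Real.norm_eq_abs, abs_mul, abs_of_pos (show (0:ℝ) < 2 by norm_num)] at b
    have := abs_nonneg (∫ x, Hh β (Real.exp (-L)) x)
    linarith
  · rw [integral_undef hi, abs_zero]; positivity

theorem fisher_information_sigma_beta (β : ℝ) (hβ : β ∈ Set.Ioo (-1 : ℝ) 1) :
    Filter.Tendsto
      (fun Δ : ℝ =>
        (∫ x : ℝ, fSig (2 - Δ) β x * fBeta (2 - Δ) β x / stableDensity (2 - Δ) β x) /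
          (Δ * Real.log (Real.log (1 / Δ))))
      (nhdsWithin 0 (Set.Ioi 0)) (nhds 0) := by
  obtain ⟨K, L0, H⟩ := final_bound (abs_lt.2 hβ)
  have hL : Tendsto (fun Δ : ℝ => Real.log (1 / Δ)) (𝓝[>] 0) atTop := by
    simp only [one_div]
    exact Real.tendsto_log_atTop.comp tendsto_inv_nhdsGT_zero
  have hLL := Real.tendsto_log_atTop.comp hL
  have hK : Tendsto (fun Δ : ℝ => K / Real.log (Real.log (1 / Δ))) (𝓝[>] 0) (𝓝 0) :=
    tendsto_const_nhds.div_atTop hLL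
  refine squeeze_zero_norm' ?_ hK
  filter_upwards [self_mem_nhdsWithin, hL.eventually_ge_atTop L0, hLL.eventually_gt_atTop 0]
    with Δ h1 h2 h3
  simp only [Function.comp] at h3
  have h1' : 0 < Δ := h1
  have e : Real.exp (-Real.log (1 / Δ)) = Δ := by
    rw [one_div, Real.log_inv, neg_neg, Real.exp_log h1']
  have b := H _ h2
  rw [e] at b
  change ‖(∫ x, Hh β Δ x) / _‖ ≤ _
  rw [norm_div, Real.norm_eq_abs, Real.norm_of_nonneg (by positivity), div_le_div_iff₀ (by positivity) h3]
  nlinarith
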